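/- Fix an integer k ≥ 2, δ > 0 and ε > 0. There is a constant C_ε such that for all Q ≥ 2 and all X with X ≥ Q^δ, | D_k(Q;X) − (ã_k/(k²−1)!) · Q X (log X)^{k²−1} | ≤ C_ε · ( Q^{1/2+ε} X (log X)^{k²−1} + Q X (log X)^{k²−2+ε} ), where D_k(Q;X) = Σ_{q≥1} Φ(q/Q) Σ_{n≥1, gcd(n,q)=1} d_k(n)² Ψ(n/X)². -/

import Mathlib

open MeasureTheory

/-- `d_k(n)`: number of ordered k-tuples of positive integers with product n. -/
noncomputable def dk (k n : ℕ) : ℕ :=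
  Nat.card {f : Fin k → ℕ // (∀ i, 0 < f i) ∧ ∏ i, f i = n}

/-- `𝔞_p`. -/
noncomputable def frakA (k p : ℕ) : ℝ :=
  ∑' ℓ : ℕ, (((k + ℓ - 1).choose (k - 1) : ℝ))^2 / (p : ℝ)^ℓ

/-- `a_k`. -/
noncomputable def aCst (k : ℕ) : ℝ :=
  ∏' p : Nat.Primes, ((1 - 1/((p : ℕ) : ℝ))^(k^2) * frakA k p)

/-- `ã_k`. -/
noncomputable def aTilde (k : ℕ) : ℝ :=
  aCst k * ∏' p : Nat.Primes, (1 - (1 - (frakA k p)⁻¹)/((p : ℕ) : ℝ))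

/-- The diagonal sum `D_k(Q;X)`. -/
noncomputable def Dk (k : ℕ) (Φ Ψ : ℝ → ℝ) (Q X : ℝ) : ℝ :=
  ∑' q : ℕ, if 1 ≤ q then
    Φ ((q : ℝ) / Q) *
      ∑' n : ℕ, (if Nat.gcd n q = 1 then (dk k n : ℝ)^2 * (Ψ ((n : ℝ) / X))^2 else 0)
  else 0

section

open ArithmeticFunction Finset
open scoped ArithmeticFunction.zeta ArithmeticFunction.Moebius

/-- Comparison of `∑ log(x/a)^j / a` with the corresponding integral. -/
lemma abs_sum_log_pow_div_sub_le (j : ℕ) {x : ℝ} (hx : 1 ≤ x) :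
    |∑ a ∈ Ioc 0 ⌊x⌋₊, (1 / (a : ℝ)) * Real.log (x / a) ^ j - Real.log x ^ (j + 1) / (j + 1)|
      ≤ Real.log x ^ j := by
  set N := ⌊x⌋₊ with hN
  have hN1 : 1 ≤ N := Nat.le_floor (by simpa using hx)
  have hNx : (N : ℝ) ≤ x := Nat.floor_le (by linarith)
  have hxN : x < N + 1 := Nat.lt_floor_add_one x
  have hN0 : (0 : ℝ) < N := by exact_mod_cast hN1
  set g : ℝ → ℝ := fun t => (1 / t) * Real.log (x / t) ^ j with hg
  have hlog : ∀ t : ℝ, 1 ≤ t → t ≤ N → 0 ≤ Real.log (x / t) := fun t h1 h2 =>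
    Real.log_nonneg (by rw [le_div_iff₀ (by linarith)]; linarith)
  have hanti : AntitoneOn g (Set.Icc ((1 : ℕ) : ℝ) (N : ℝ)) := by
    intro s hs t ht hst
    simp only [Nat.cast_one, Set.mem_Icc] at hs ht
    have hs0 : 0 < s := by linarith
    have ht0 : 0 < t := by linarith
    have := hlog t ht.1 ht.2
    have hle : Real.log (x / t) ≤ Real.log (x / s) :=
      Real.log_le_log (by positivity) (by gcongr)
    simp only [hg]
    gcongr
  have hint : ∫ t in ((1 : ℕ) : ℝ)..(N : ℝ), g t
      = (Real.log x ^ (j + 1) - Real.log (x / N) ^ (j + 1)) / (j + 1) := by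
    have hd : ∀ t ∈ Set.uIcc ((1 : ℕ) : ℝ) (N : ℝ),
        HasDerivAt (fun t => -(Real.log (x / t) ^ (j + 1) / (j + 1))) (g t) t := by
      intro t ht
      rw [Set.uIcc_of_le (by exact_mod_cast hN1)] at ht
      have ht0 : 0 < t := by have := ht.1; push_cast at this; linarith
      have hx0 : 0 < x := by linarith
      have h1 : HasDerivAt (fun t => x / t) (-x / t ^ 2) t := by
        have := (hasDerivAt_inv ht0.ne').const_mul x
        simpa [div_eq_mul_inv] using this
      have h2 := (h1.log (by positivity)).pow (j + 1)
      have h3 := (h2.div_const ((j : ℝ) + 1)).neg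
      refine h3.congr_deriv ?_
      simp only [hg]
      field_simp
      push_cast
      simp
    rw [intervalIntegral.integral_eq_sub_of_hasDerivAt hd]
    · simp; ring
    · apply ContinuousOn.intervalIntegrable
      intro t ht
      rw [Set.uIcc_of_le (by exact_mod_cast hN1)] at ht
      have ht0 : 0 < t := by have := ht.1; push_cast at this; linarith
      have hx0 : x / t ≠ 0 := by have : 0 < x := by linarith
                                 positivity
      apply ContinuousAt.continuousWithinAt
      simp only [hg]
      fun_prop (disch := first | exact ht0.ne' | exact hx0)
  have hup := hanti.sum_le_integral_Ico hN1
  have hlo := hanti.integral_le_sum_Ico hN1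
  have hS1 : ∑ a ∈ Ioc 0 N, g a = g 1 + ∑ i ∈ Ico 1 N, g ((i + 1 : ℕ) : ℝ) := by
    rw [Finset.sum_Ico_add' (fun i : ℕ => g i) 1 N 1, ← Finset.Ico_add_one_add_one_eq_Ioc,
      zero_add, Finset.sum_eq_sum_Ico_succ_bot (by omega)]
    simp
  have hS2 : ∑ a ∈ Ioc 0 N, g a = ∑ i ∈ Ico 1 N, g (i : ℝ) + g N := by
    rw [← Finset.Ico_add_one_add_one_eq_Ioc, zero_add, Finset.sum_Ico_succ_top hN1]
  have hL : 0 ≤ Real.log x := Real.log_nonneg hx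
  have hj : (0 : ℝ) < j + 1 := by positivity
  have hl0 := hlog N (by exact_mod_cast hN1) le_rfl
  have hg1 : g 1 = Real.log x ^ j := by simp [hg]
  have hgN : Real.log (x / N) ^ (j + 1) / (j + 1) ≤ g N := by
    have h1 : Real.log (x / N) ≤ 1 / N := by
      have := Real.log_le_sub_one_of_pos (show 0 < x / N by have : 0 < x := by linarith
                                                            positivity)
      have h2 : x / N ≤ 1 + 1 / N := by
        rw [div_le_iff₀ hN0]; field_simp; linarith
      linarith
    calc Real.log (x / N) ^ (j + 1) / (j + 1) ≤ Real.log (x / N) ^ (j + 1) :=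
          div_le_self (by positivity) (by linarith [Nat.cast_nonneg (α := ℝ) j])
      _ = Real.log (x / N) * Real.log (x / N) ^ j := by ring
      _ ≤ g N := by simp only [hg]; gcongr
  rw [hint] at hup hlo
  have e : (Real.log x ^ (j + 1) - Real.log (x / N) ^ (j + 1)) / (j + 1)
      = Real.log x ^ (j + 1) / (j + 1) - Real.log (x / N) ^ (j + 1) / (j + 1) := by ring
  have hq : 0 ≤ Real.log (x / N) ^ (j + 1) / ((j : ℝ) + 1) := by positivity
  have hLj : 0 ≤ Real.log x ^ j := by positivity
  change |∑ a ∈ Ioc 0 N, g a - _| ≤ _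
  rw [abs_le]
  constructor <;> linarith

/-- Summatory function of the `m`-fold divisor function. -/
noncomputable def divisorSum (m : ℕ) (x : ℝ) : ℝ :=
  ∑ n ∈ Ioc 0 ⌊x⌋₊, ((ζ : ArithmeticFunction ℝ) ^ m) n

lemma sum_Ioc_mul_floor (f g : ArithmeticFunction ℝ) {x : ℝ} :
    ∑ n ∈ Ioc 0 ⌊x⌋₊, (f * g) n
      = ∑ a ∈ Ioc 0 ⌊x⌋₊, f a * ∑ b ∈ Ioc 0 ⌊x / a⌋₊, g b := by
  rw [sum_Ioc_mul_eq_sum_sum]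
  refine sum_congr rfl fun a _ => ?_
  rw [Nat.floor_div_natCast]

lemma divisorSum_succ (m : ℕ) (x : ℝ) :
    divisorSum (m + 1) x = ∑ a ∈ Ioc 0 ⌊x⌋₊, divisorSum m (x / a) := by
  unfold divisorSum
  rw [pow_succ', sum_Ioc_mul_floor]
  refine sum_congr rfl fun a ha => ?_
  have : a ≠ 0 := by simp at ha; omega
  simp [this]

lemma one_le_div_of_mem_Ioc_floor {x : ℝ} (hx : 1 ≤ x) {a : ℕ} (ha : a ∈ Ioc 0 ⌊x⌋₊) :
    (1 : ℝ) ≤ a ∧ 1 ≤ x / a ∧ Real.log (x / a) ≤ Real.log x ∧ 0 ≤ Real.log (x / a) := by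
  rw [mem_Ioc] at ha
  have h1 : (1 : ℝ) ≤ a := by exact_mod_cast ha.1
  have h2 : (a : ℝ) ≤ x := (Nat.cast_le.mpr ha.2).trans (Nat.floor_le (by linarith))
  have h3 : 1 ≤ x / a := by rw [le_div_iff₀ (by linarith)]; linarith
  refine ⟨h1, h3, Real.log_le_log (by linarith) (div_le_self (by linarith) h1),
    Real.log_nonneg h3⟩

/-- Leading asymptotics of the summatory function of the divisor functions. -/
lemma exists_abs_divisorSum_sub_le (j : ℕ) : ∃ C : ℝ, 0 ≤ C ∧ ∀ x : ℝ, 1 ≤ x →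
    |divisorSum (j + 2) x - x * Real.log x ^ (j + 1) / (j + 1).factorial|
      ≤ C * x * (1 + Real.log x) ^ j := by
  induction j with
  | zero =>
    refine ⟨2, by norm_num, fun x hx => ?_⟩
    have hN : (⌊x⌋₊ : ℝ) ≤ x := Nat.floor_le (by linarith)
    have h1 := abs_sum_log_pow_div_sub_le 0 hx
    have h2 : |divisorSum 2 x - ∑ a ∈ Ioc 0 ⌊x⌋₊, x * (1 / (a : ℝ))| ≤ x := by
      rw [divisorSum_succ, ← sum_sub_distrib]
      refine (abs_sum_le_sum_abs _ _).trans (le_trans (sum_le_sum (g := fun _ => (1 : ℝ)) ?_) ?_)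
      · intro a ha
        obtain ⟨ha1, hxa, -, -⟩ := one_le_div_of_mem_Ioc_floor hx ha
        have : divisorSum 1 (x / a) = ⌊x / a⌋₊ := by
          unfold divisorSum
          rw [pow_one]
          have := sum_Ioc_zeta ⌊x / a⌋₊
          simp only [natCoe_apply]
          exact_mod_cast this
        rw [this]
        have := Nat.floor_le (show 0 ≤ x / a by linarith)
        have := Nat.lt_floor_add_one (x / a)
        rw [abs_le, mul_one_div]
        constructor <;> linarith
      · simpa using hN
    rw [← mul_sum] at h2
    simp only [pow_zero, mul_one, zero_add, pow_one, Nat.cast_zero, div_one] at h1 h2 ⊢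
    rw [Nat.factorial_one, Nat.cast_one, div_one]
    have h3 : |x * ∑ a ∈ Ioc 0 ⌊x⌋₊, 1 / (a : ℝ) - x * Real.log x| ≤ x := by
      rw [← mul_sub, abs_mul, abs_of_nonneg (by linarith)]
      exact mul_le_of_le_one_right (by linarith) h1
    calc _ ≤ _ := abs_sub_le _ (x * ∑ a ∈ Ioc 0 ⌊x⌋₊, 1 / (a : ℝ)) _
      _ ≤ 2 * x := by linarith
  | succ j ih =>
    obtain ⟨C, hC, h⟩ := ih
    refine ⟨C + C + 1, by linarith, fun x hx => ?_⟩
    have hL : 0 ≤ Real.log x := Real.log_nonneg hx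
    have h0 := abs_sum_log_pow_div_sub_le 0 hx
    simp only [pow_zero, mul_one, zero_add, pow_one, Nat.cast_zero, div_one] at h0
    have h1 := abs_sum_log_pow_div_sub_le (j + 1) hx
    rw [divisorSum_succ]
    set M := ∑ a ∈ Ioc 0 ⌊x⌋₊, x / ((j + 1).factorial : ℝ) *
      ((1 / (a : ℝ)) * Real.log (x / a) ^ (j + 1)) with hM
    have h2 : |∑ a ∈ Ioc 0 ⌊x⌋₊, divisorSum (j + 2) (x / a) - M|
        ≤ C * x * (1 + Real.log x) ^ (j + 1) := by
      rw [hM, ← sum_sub_distrib]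
      calc _ ≤ _ := abs_sum_le_sum_abs _ _
        _ ≤ ∑ a ∈ Ioc 0 ⌊x⌋₊, C * x * (1 + Real.log x) ^ j * (1 / (a : ℝ)) := by
          refine sum_le_sum fun a ha => ?_
          obtain ⟨ha1, hxa, hl, hl0⟩ := one_le_div_of_mem_Ioc_floor hx ha
          have := h (x / a) hxa
          rw [show x / ((j + 1).factorial : ℝ) * ((1 / (a : ℝ)) * Real.log (x / a) ^ (j + 1))
            = x / a * Real.log (x / a) ^ (j + 1) / (j + 1).factorial by ring]
          refine this.trans ?_
          rw [show C * x * (1 + Real.log x) ^ j * (1 / (a : ℝ))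
            = C * (x / a) * (1 + Real.log x) ^ j by ring]
          gcongr
        _ = C * x * (1 + Real.log x) ^ j * ∑ a ∈ Ioc 0 ⌊x⌋₊, (1 / (a : ℝ)) := by
          rw [mul_sum]
        _ ≤ C * x * (1 + Real.log x) ^ j * (1 + Real.log x) := by
          gcongr
          linarith [(abs_le.mp h0).2]
        _ = _ := by ring
    have h3 : |M - x * Real.log x ^ (j + 1 + 1) / (j + 1 + 1).factorial|
        ≤ x * (1 + Real.log x) ^ (j + 1) := by
      rw [hM, ← mul_sum, Nat.factorial_succ (j + 1)]
      rw [show x * Real.log x ^ (j + 1 + 1) / (((j + 1 + 1) * (j + 1).factorial : ℕ) : ℝ)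
        = x / ((j + 1).factorial : ℝ) * (Real.log x ^ (j + 1 + 1) / ((j + 1 : ℕ) + 1)) by
          push_cast; field_simp]
      rw [← mul_sub, abs_mul, abs_of_nonneg (by positivity)]
      have hf : (1 : ℝ) ≤ (j + 1).factorial := by exact_mod_cast Nat.factorial_pos _
      calc _ ≤ x * (Real.log x) ^ (j + 1) := by
            gcongr
            exact div_le_self (by linarith) hf
        _ ≤ _ := by gcongr; linarith
    calc _ ≤ _ := abs_sub_le _ M _
      _ ≤ C * x * (1 + Real.log x) ^ (j + 1) + x * (1 + Real.log x) ^ (j + 1) := add_le_add h2 h3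
      _ ≤ _ := by
        have : 0 ≤ C * x * (1 + Real.log x) ^ (j + 1) := by positivity
        nlinarith

lemma pow_succ_sub_pow_succ_le {a b : ℝ} (j : ℕ) (hb : 0 ≤ b) (hab : b ≤ a) :
    a ^ (j + 1) - b ^ (j + 1) ≤ (j + 1) * (a - b) * a ^ j := by
  induction j with
  | zero => simp
  | succ j ih =>
    have h1 : b ^ (j + 1) ≤ a ^ (j + 1) := by gcongr
    have h2 := mul_le_mul_of_nonneg_left ih (hb.trans hab)
    have h3 := mul_le_mul_of_nonneg_left h1 (sub_nonneg.mpr hab)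
    push_cast
    calc a ^ (j + 1 + 1) - b ^ (j + 1 + 1)
        = a * (a ^ (j + 1) - b ^ (j + 1)) + (a - b) * b ^ (j + 1) := by ring
      _ ≤ a * ((j + 1) * (a - b) * a ^ j) + (a - b) * a ^ (j + 1) := by linarith
      _ = _ := by ring

lemma summable_abs_div_mul_log {h : ℕ → ℝ}
    (hs : Summable fun n : ℕ => |h n| / (n : ℝ) ^ (3 / 4 : ℝ)) :
    (Summable fun n : ℕ => |h n| / n) ∧ Summable fun n : ℕ => |h n| / n * Real.log n := by
  have key : ∀ n : ℕ, n ≠ 0 → |h n| / (n : ℝ) ^ (3 / 4 : ℝ)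
      = |h n| / n * (n : ℝ) ^ (1 / 4 : ℝ) := by
    intro n hn
    have hn' : (0 : ℝ) < n := by positivity
    have : (n : ℝ) ^ (3 / 4 : ℝ) * (n : ℝ) ^ (1 / 4 : ℝ) = n := by
      rw [← Real.rpow_add hn']; norm_num
    have h2 : (n : ℝ) ^ (3 / 4 : ℝ) ≠ 0 := by positivity
    rw [div_mul_eq_mul_div, div_eq_div_iff h2 hn'.ne']
    linear_combination (-|h n|) * this
  constructor
  · refine hs.of_nonneg_of_le (fun n => by positivity) fun n => ?_
    rcases eq_or_ne n 0 with rfl | hn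
    · simp
    rw [key n hn]
    refine le_mul_of_one_le_right (by positivity) (Real.one_le_rpow ?_ (by norm_num))
    exact_mod_cast Nat.one_le_iff_ne_zero.mpr hn
  · refine (hs.mul_left 4).of_nonneg_of_le
      (fun n => mul_nonneg (by positivity) (Real.log_natCast_nonneg n)) fun n => ?_
    rcases eq_or_ne n 0 with rfl | hn
    · simp
    rw [key n hn, mul_left_comm]
    refine mul_le_mul_of_nonneg_left ?_ (by positivity)
    refine (Real.log_le_rpow_div (Nat.cast_nonneg n) (show (0 : ℝ) < 1 / 4 by norm_num)).trans ?_
    rw [div_div_eq_mul_div]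
    linarith

/-- Summatory function of a convolution of a divisor function with a rapidly convergent one. -/
lemma exists_abs_sum_mul_zeta_pow_sub_le (h : ArithmeticFunction ℝ) (j : ℕ)
    (hs : Summable fun n : ℕ => |h n| / (n : ℝ) ^ (3 / 4 : ℝ)) :
    ∃ C : ℝ, 0 ≤ C ∧ ∀ x : ℝ, 1 ≤ x →
      |∑ n ∈ Ioc 0 ⌊x⌋₊, (h * (ζ : ArithmeticFunction ℝ) ^ (j + 2)) n
          - (∑' n : ℕ, h n / n) * (x * Real.log x ^ (j + 1) / (j + 1).factorial)|
        ≤ C * x * (1 + Real.log x) ^ j := by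
  obtain ⟨C, hC, hD⟩ := exists_abs_divisorSum_sub_le j
  obtain ⟨hs1, hs2⟩ := summable_abs_div_mul_log hs
  set K : ℕ → ℝ := fun n => C * (|h n| / n) + (j + 1) * (|h n| / n * Real.log n) with hK
  have hKs : Summable K := (hs1.mul_left C).add (hs2.mul_left _)
  have hK0 : ∀ n, 0 ≤ K n := fun n => by
    have := Real.log_natCast_nonneg n
    positivity
  refine ⟨∑' n, K n, tsum_nonneg hK0, fun x hx => ?_⟩
  have hL : 0 ≤ Real.log x := Real.log_nonneg hx
  have hx0 : 0 < x := by linarith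
  set Y := x * Real.log x ^ (j + 1) / ((j + 1).factorial : ℝ) with hY
  have hY0 : 0 ≤ Y := by positivity
  have hsum1 : HasSum (fun n => if n ∈ Ioc 0 ⌊x⌋₊ then h n * divisorSum (j + 2) (x / n) else 0)
      (∑ n ∈ Ioc 0 ⌊x⌋₊, (h * (ζ : ArithmeticFunction ℝ) ^ (j + 2)) n) := by
    rw [sum_Ioc_mul_floor]
    have := hasSum_sum_of_ne_finset_zero (L := .unconditional ℕ) (f := fun n => if n ∈ Ioc 0 ⌊x⌋₊ then
      h n * divisorSum (j + 2) (x / n) else 0) (s := Ioc 0 ⌊x⌋₊) (fun b hb => by simp only [if_neg hb])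
    convert this using 1
    exact sum_congr rfl fun a ha => by rw [if_pos ha]; rfl
  have hsum2 : HasSum (fun n : ℕ => h n / n * Y) ((∑' n : ℕ, h n / n) * Y) := by
    refine HasSum.mul_right _ (Summable.hasSum ?_)
    refine Summable.of_abs ?_
    refine hs1.congr fun n => ?_
    rw [abs_div, Nat.abs_cast]
  have hsum := hsum1.sub hsum2
  have hf : (1 : ℝ) ≤ (j + 1).factorial := by exact_mod_cast Nat.factorial_pos _
  have hpow : Real.log x ^ j ≤ (1 + Real.log x) ^ j := by gcongr; linarith
  have hbound : ∀ n, ‖(if n ∈ Ioc 0 ⌊x⌋₊ then h n * divisorSum (j + 2) (x / n) else 0)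
      - h n / n * Y‖ ≤ K n * (x * (1 + Real.log x) ^ j) := by
    intro n
    rw [Real.norm_eq_abs]
    have hl0 := Real.log_natCast_nonneg n
    split_ifs with hn
    · obtain ⟨ha1, hxa, hl, hl0'⟩ := one_le_div_of_mem_Ioc_floor hx hn
      have hn0 : (0 : ℝ) < n := by linarith
      have h1 := hD (x / n) hxa
      have hlog : Real.log (x / n) = Real.log x - Real.log n := Real.log_div hx0.ne' hn0.ne'
      have h2 := pow_succ_sub_pow_succ_le j hl0' hl
      have h2' : Real.log (x / n) ^ (j + 1) ≤ Real.log x ^ (j + 1) := by gcongr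
      have h3 : |x / n * Real.log (x / n) ^ (j + 1) / (j + 1).factorial - Y / n|
          ≤ x / n * ((j + 1) * Real.log n * (1 + Real.log x) ^ j) := by
        rw [show x / n * Real.log (x / n) ^ (j + 1) / (j + 1).factorial - Y / n
          = x / n * ((Real.log (x / n) ^ (j + 1) - Real.log x ^ (j + 1)) / (j + 1).factorial) by
            rw [hY]; field_simp]
        rw [abs_mul, abs_of_nonneg (show 0 ≤ x / n by positivity), abs_div, Nat.abs_cast,
          abs_of_nonpos (by linarith)]
        gcongr
        refine (div_le_self (by linarith) hf).trans ?_
        rw [neg_sub]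
        refine h2.trans ?_
        rw [hlog, sub_sub_cancel]
        gcongr
      have h4 : |divisorSum (j + 2) (x / n) - Y / n|
          ≤ C * (x / n) * (1 + Real.log x) ^ j
            + x / n * ((j + 1) * Real.log n * (1 + Real.log x) ^ j) := by
        refine (abs_sub_le _ _ _).trans (add_le_add (h1.trans ?_) h3)
        gcongr
      rw [show h n * divisorSum (j + 2) (x / n) - h n / n * Y
        = h n * (divisorSum (j + 2) (x / n) - Y / n) by ring, abs_mul]
      refine (mul_le_mul_of_nonneg_left h4 (abs_nonneg _)).trans (le_of_eq ?_)
      rw [hK]; ring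
    · rw [zero_sub, abs_neg, abs_mul, abs_div, Nat.abs_cast, abs_of_nonneg hY0]
      rcases eq_or_ne n 0 with rfl | hn0
      · simp [hK]
      have hxn : x < n := by
        rw [mem_Ioc, not_and_or, not_le] at hn
        rcases hn with hn | hn
        · omega
        · exact (Nat.floor_lt hx0.le).mp hn
      have hle : Real.log x ≤ Real.log n := Real.log_le_log hx0 hxn.le
      have hYle : Y ≤ (j + 1) * Real.log n * (x * (1 + Real.log x) ^ j) := by
        calc Y ≤ x * Real.log x ^ (j + 1) := div_le_self (by positivity) hf
          _ = Real.log x * (x * Real.log x ^ j) := by ring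
          _ ≤ Real.log n * (x * (1 + Real.log x) ^ j) := by gcongr
          _ ≤ (j + 1) * (Real.log n * (x * (1 + Real.log x) ^ j)) :=
            le_mul_of_one_le_left (by positivity) (by linarith [Nat.cast_nonneg (α := ℝ) j])
          _ = _ := by ring
      calc |h n| / n * Y ≤ |h n| / n * ((j + 1) * Real.log n * (x * (1 + Real.log x) ^ j)) := by
            gcongr
        _ ≤ C * (|h n| / n) * (x * (1 + Real.log x) ^ j)
            + |h n| / n * ((j + 1) * Real.log n * (x * (1 + Real.log x) ^ j)) :=
          le_add_of_nonneg_left (by positivity)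
        _ = _ := by rw [hK]; ring
  have := tsum_of_norm_bounded (hKs.hasSum.mul_right (x * (1 + Real.log x) ^ j)) hbound
  rw [hsum.tsum_eq, Real.norm_eq_abs] at this
  rw [mul_assoc]
  exact this

/-- Passing from a sharp to a smooth cutoff. -/
lemma abs_sum_mul_smooth_sub_le {W : ℝ → ℝ} (hW : ContDiff ℝ 1 W) (hWs : HasCompactSupport W)
    {a b : ℝ} (hab : tsupport W ⊆ Set.Icc a b) (c : ℕ → ℝ) {X : ℝ} (hX : 0 < X) {N : ℕ}
    (hN : b * X ≤ N) {M E : ℝ}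
    (hE : ∀ u ∈ Set.Icc a b, |∑ n ∈ Ioc 0 ⌊u * X⌋₊, c n - M * u| ≤ E) :
    |∑ n ∈ Ioc 0 N, c n * W (n / X) - M * ∫ u, W u| ≤ E * ∫ u, |deriv W u| := by
  have hWd : Continuous (deriv W) := hW.continuous_deriv le_rfl
  have hWds : HasCompactSupport (deriv W) := hWs.deriv
  have hint : Integrable (deriv W) := hWd.integrable_of_hasCompactSupport hWds
  have h1 : ∀ n : ℕ, W (n / X) = - ∫ u, (Set.Ici ((n : ℝ) / X)).indicator (deriv W) u := by
    intro n
    rw [integral_indicator measurableSet_Ici, integral_Ici_eq_integral_Ioi,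
      HasCompactSupport.integral_Ioi_deriv_eq hW hWs, neg_neg]
  have hind : ∀ n : ℕ, Integrable ((Set.Ici ((n : ℝ) / X)).indicator (deriv W)) := fun n =>
    hint.indicator measurableSet_Ici
  have h2 : ∑ n ∈ Ioc 0 N, c n * W (n / X)
      = - ∫ u, ∑ n ∈ Ioc 0 N, c n * (Set.Ici ((n : ℝ) / X)).indicator (deriv W) u := by
    rw [integral_finsetSum _ fun n _ => (hind n).const_mul _, ← sum_neg_distrib]
    refine sum_congr rfl fun n _ => ?_
    rw [integral_const_mul, h1 n, mul_neg]
  have h3 : ∫ u, u * deriv W u = - ∫ u, W u := by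
    have := integral_mul_deriv_eq_deriv_mul_of_integrable (u := fun u => u) (v := W)
      (u' := fun _ => 1) (v' := deriv W) (fun x _ => hasDerivAt_id x)
      (fun x _ => (hW.differentiable one_ne_zero x).hasDerivAt)
      ((continuous_id.mul hWd).integrable_of_hasCompactSupport hWds.mul_left)
      (by simpa [Pi.mul_def] using hW.continuous.integrable_of_hasCompactSupport hWs)
      ((continuous_id.mul hW.continuous).integrable_of_hasCompactSupport hWs.mul_left)
    simpa using this
  have hintid : Integrable fun u => u * deriv W u :=
    (continuous_id.mul hWd).integrable_of_hasCompactSupport hWds.mul_left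
  have h4 : ∑ n ∈ Ioc 0 N, c n * W (n / X) - M * ∫ u, W u
      = - ∫ u, (∑ n ∈ Ioc 0 N, c n * (Set.Ici ((n : ℝ) / X)).indicator (deriv W) u
          - M * (u * deriv W u)) := by
    rw [integral_sub (integrable_finsetSum _ fun n _ => (hind n).const_mul _)
      (hintid.const_mul M), integral_const_mul, h3, h2]
    ring
  rw [h4, abs_neg, ← integral_const_mul, ← Real.norm_eq_abs]
  refine norm_integral_le_of_norm_le (hint.abs.const_mul E) (Filter.Eventually.of_forall fun u => ?_)
  rw [Real.norm_eq_abs]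
  by_cases hu : deriv W u = 0
  · have : ∀ n : ℕ, (Set.Ici ((n : ℝ) / X)).indicator (deriv W) u = 0 := fun n => by
      simp [Set.indicator_apply, hu]
    simp [this, hu]
  have hu' : u ∈ Set.Icc a b := hab (support_deriv_subset hu)
  have hF : ∑ n ∈ Ioc 0 N, c n * (Set.Ici ((n : ℝ) / X)).indicator (deriv W) u
      = (∑ n ∈ Ioc 0 ⌊u * X⌋₊, c n) * deriv W u := by
    have hsub : Ioc 0 ⌊u * X⌋₊ ⊆ Ioc 0 N := by
      refine Ioc_subset_Ioc_right (Nat.floor_le_of_le ?_)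
      exact (mul_le_mul_of_nonneg_right hu'.2 hX.le).trans hN
    rw [sum_mul, ← sum_subset_zero_on_sdiff hsub ?_ fun n hn => ?_]
    · intro n hn
      rw [mem_sdiff, mem_Ioc, mem_Ioc, not_and, not_le] at hn
      have := Nat.lt_of_floor_lt (hn.2 hn.1.1)
      rw [Set.indicator_of_notMem, mul_zero]
      rw [Set.mem_Ici, not_le, lt_div_iff₀ hX]
      exact this
    · rw [mem_Ioc] at hn
      rw [Set.indicator_of_mem]
      rw [Set.mem_Ici, div_le_iff₀ hX]
      exact (Nat.le_floor_iff' (by omega)).mp hn.2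
  rw [hF, show (∑ n ∈ Ioc 0 ⌊u * X⌋₊, c n) * deriv W u - M * (u * deriv W u)
    = (∑ n ∈ Ioc 0 ⌊u * X⌋₊, c n - M * u) * deriv W u by ring, abs_mul]
  exact mul_le_mul_of_nonneg_right (hE u hu') (abs_nonneg _)

/-- Polynomial growth in the exponent along prime powers, uniformly in the prime. -/
def PrimePowBounded (f : ArithmeticFunction ℝ) : Prop :=
  ∃ (A : ℝ) (a : ℕ), 0 ≤ A ∧ ∀ p : ℕ, p.Prime → ∀ j : ℕ, |f (p ^ j)| ≤ A * ((j : ℝ) + 1) ^ a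

lemma mul_apply_prime_pow (f g : ArithmeticFunction ℝ) {p : ℕ} (hp : p.Prime) (j : ℕ) :
    (f * g) (p ^ j) = ∑ i ∈ antidiagonal j, f (p ^ i.1) * g (p ^ i.2) := by
  rw [mul_apply, Nat.sum_divisorsAntidiagonal (fun a b => f a * g b), Nat.sum_divisors_prime_pow hp,
    Finset.Nat.sum_antidiagonal_eq_sum_range_succ (fun a b => f (p ^ a) * g (p ^ b))]
  refine sum_congr rfl fun i hi => ?_
  rw [Nat.pow_div (by simp at hi; omega) hp.pos]

lemma PrimePowBounded.of_abs_le_one {f : ArithmeticFunction ℝ} (hf : ∀ n, |f n| ≤ 1) :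
    PrimePowBounded f :=
  ⟨1, 0, zero_le_one, fun p _ j => by simpa using hf (p ^ j)⟩

lemma PrimePowBounded.mul {f g : ArithmeticFunction ℝ} (hf : PrimePowBounded f)
    (hg : PrimePowBounded g) : PrimePowBounded (f * g) := by
  obtain ⟨A, a, hA, hf⟩ := hf
  obtain ⟨B, b, hB, hg⟩ := hg
  refine ⟨A * B, a + b + 1, by positivity, fun p hp j => ?_⟩
  rw [mul_apply_prime_pow f g hp]
  calc _ ≤ _ := abs_sum_le_sum_abs _ _
    _ ≤ ∑ _i ∈ antidiagonal j, A * B * ((j : ℝ) + 1) ^ (a + b) := by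
      refine sum_le_sum fun i hi => ?_
      rw [HasAntidiagonal.mem_antidiagonal] at hi
      have h1 : (i.1 : ℝ) ≤ j := by exact_mod_cast (show i.1 ≤ j by omega)
      have h2 : (i.2 : ℝ) ≤ j := by exact_mod_cast (show i.2 ≤ j by omega)
      rw [abs_mul]
      calc _ ≤ (A * ((i.1 : ℝ) + 1) ^ a) * (B * ((i.2 : ℝ) + 1) ^ b) := by
            gcongr
            · exact hf p hp i.1
            · exact hg p hp i.2
        _ ≤ (A * ((j : ℝ) + 1) ^ a) * (B * ((j : ℝ) + 1) ^ b) := by gcongr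
        _ = _ := by ring
    _ = _ := by
      rw [sum_const, Finset.Nat.card_antidiagonal, nsmul_eq_mul]
      push_cast
      ring

lemma PrimePowBounded.pmul {f g : ArithmeticFunction ℝ} (hf : PrimePowBounded f)
    (hg : PrimePowBounded g) : PrimePowBounded (f.pmul g) := by
  obtain ⟨A, a, hA, hf⟩ := hf
  obtain ⟨B, b, hB, hg⟩ := hg
  refine ⟨A * B, a + b, by positivity, fun p hp j => ?_⟩
  rw [pmul_apply, abs_mul]
  calc _ ≤ (A * ((j : ℝ) + 1) ^ a) * (B * ((j : ℝ) + 1) ^ b) := by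
        gcongr
        · exact hf p hp j
        · exact hg p hp j
    _ = _ := by ring

lemma PrimePowBounded.pow {f : ArithmeticFunction ℝ} (hf : PrimePowBounded f) (m : ℕ) :
    PrimePowBounded (f ^ m) := by
  induction m with
  | zero =>
    refine .of_abs_le_one fun n => ?_
    rw [pow_zero, one_apply]
    split_ifs <;> simp
  | succ m ih => exact pow_succ f m ▸ ih.mul hf

lemma primePowBounded_zeta : PrimePowBounded (ζ : ArithmeticFunction ℝ) :=
  .of_abs_le_one fun n => by
    rw [natCoe_apply, zeta_apply]
    split_ifs <;> simp

lemma primePowBounded_moebius : PrimePowBounded (μ : ArithmeticFunction ℝ) :=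
  .of_abs_le_one fun n => by
    rw [intCoe_apply]
    exact_mod_cast abs_moebius_le_one (n := n)

lemma summable_succ_pow_mul_geometric (a : ℕ) {r : ℝ} (hr0 : 0 ≤ r) (hr : r < 1) :
    Summable fun j : ℕ => ((j : ℝ) + 1) ^ a * r ^ j := by
  rcases hr0.eq_or_lt with rfl | hr0
  · refine summable_of_ne_finset_zero (s := {0}) fun j hj => ?_
    rw [mem_singleton] at hj
    rw [zero_pow hj, mul_zero]
  have h := summable_pow_mul_geometric_of_norm_lt_one a (r := r) (by
    rwa [Real.norm_eq_abs, abs_of_pos hr0])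
  have h2 := ((summable_nat_add_iff 1).mpr h).mul_left r⁻¹
  refine h2.congr fun j => ?_
  push_cast
  field_simp
  ring

lemma PrimePowBounded.summable_norm {f : ArithmeticFunction ℝ} (hf : PrimePowBounded f) {p : ℕ}
    (hp : p.Prime) {r : ℝ} (hr0 : 0 ≤ r) (hr : r < 1) :
    Summable fun j : ℕ => ‖f (p ^ j) * r ^ j‖ := by
  obtain ⟨A, a, hA, hf⟩ := hf
  refine ((summable_succ_pow_mul_geometric a hr0 hr).mul_left A).of_nonneg_of_le
    (fun j => norm_nonneg _) fun j => ?_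
  rw [norm_mul, Real.norm_eq_abs, Real.norm_of_nonneg (by positivity), ← mul_assoc]
  gcongr
  exact hf p hp j

/-- The Euler factor at `p` of the Dirichlet series of `f`, evaluated at `1`. -/
noncomputable def localFactor (f : ArithmeticFunction ℝ) (p : ℕ) : ℝ :=
  ∑' j : ℕ, f (p ^ j) * ((p : ℝ)⁻¹) ^ j

lemma inv_prime_lt_one {p : ℕ} (hp : p.Prime) : ((p : ℝ))⁻¹ < 1 :=
  inv_lt_one_of_one_lt₀ (by exact_mod_cast hp.one_lt)

lemma localFactor_mul {f g : ArithmeticFunction ℝ} (hf : PrimePowBounded f)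
    (hg : PrimePowBounded g) {p : ℕ} (hp : p.Prime) :
    localFactor (f * g) p = localFactor f p * localFactor g p := by
  have h0 : (0 : ℝ) ≤ (p : ℝ)⁻¹ := by positivity
  unfold localFactor
  rw [tsum_mul_tsum_eq_tsum_sum_antidiagonal_of_summable_norm
    (hf.summable_norm hp h0 (inv_prime_lt_one hp)) (hg.summable_norm hp h0 (inv_prime_lt_one hp))]
  refine tsum_congr fun j => ?_
  rw [mul_apply_prime_pow f g hp, sum_mul]
  refine sum_congr rfl fun i hi => ?_
  rw [HasAntidiagonal.mem_antidiagonal] at hi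
  rw [← hi, pow_add]
  ring

lemma localFactor_moebius {p : ℕ} (hp : p.Prime) :
    localFactor (μ : ArithmeticFunction ℝ) p = 1 - 1 / (p : ℝ) := by
  unfold localFactor
  rw [tsum_eq_sum (s := range 2)]
  · simp [sum_range_succ, moebius_apply_prime hp]
    ring
  · intro j hj
    rw [mem_range] at hj
    rw [intCoe_apply, moebius_apply_prime_pow hp (by omega), if_neg (by omega)]
    simp

lemma localFactor_moebius_pow {p : ℕ} (hp : p.Prime) (m : ℕ) :
    localFactor ((μ : ArithmeticFunction ℝ) ^ m) p = (1 - 1 / (p : ℝ)) ^ m := by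
  induction m with
  | zero =>
    unfold localFactor
    rw [tsum_eq_single 0]
    · simp
    · intro j hj
      rw [pow_zero, one_apply_ne, zero_mul]
      exact (Nat.one_lt_pow hj hp.one_lt).ne'
  | succ m ih =>
    rw [pow_succ, localFactor_mul (primePowBounded_moebius.pow m) primePowBounded_moebius hp, ih,
      localFactor_moebius hp, pow_succ]

lemma mul_apply_prime {f g : ArithmeticFunction ℝ} (hf : f 1 = 1) (hg : g 1 = 1) {p : ℕ}
    (hp : p.Prime) : (f * g) p = f p + g p := by
  have := mul_apply_prime_pow f g hp 1
  rw [pow_one] at this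
  rw [this]
  simp [Finset.Nat.antidiagonal_succ, hf, hg, add_comm]

lemma isMultiplicative_moebius_pow (m : ℕ) :
    ((μ : ArithmeticFunction ℝ) ^ m).IsMultiplicative :=
  IsMultiplicative.pow isMultiplicative_moebius.intCast

lemma moebius_pow_apply_prime (m : ℕ) {p : ℕ} (hp : p.Prime) :
    ((μ : ArithmeticFunction ℝ) ^ m) p = -m := by
  induction m with
  | zero => simp [one_apply_ne hp.one_lt.ne']
  | succ m ih =>
    rw [pow_succ, mul_apply_prime (isMultiplicative_moebius_pow m).map_one
      (isMultiplicative_moebius.intCast).map_one hp, ih, intCoe_apply, moebius_apply_prime hp]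
    push_cast
    ring

/-- A multiplicative nonnegative function is summable once its values at prime powers are. -/
lemma summable_of_prime_pow_le {g : ℕ → ℝ} (h0 : g 0 = 0) (h1 : g 1 = 1)
    (hmul : ∀ {m n : ℕ}, m.Coprime n → g (m * n) = g m * g n) (hg : ∀ n, 0 ≤ g n)
    {S : ℕ → ℝ} {T : ℕ → ℝ} (hS : Summable S) (hT : Summable T) (hS0 : ∀ p, 0 ≤ S p)
    (hT0 : ∀ j, 0 ≤ T j)
    (hle : ∀ p : ℕ, p.Prime → ∀ j : ℕ, g (p ^ (j + 1)) ≤ S p * T j) : Summable g := by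
  have hsum : ∀ {p : ℕ}, p.Prime → Summable fun j : ℕ => ‖g (p ^ j)‖ := by
    intro p hp
    rw [← summable_nat_add_iff 1]
    refine (hT.mul_left (S p)).of_nonneg_of_le (fun j => norm_nonneg _) fun j => ?_
    rw [Real.norm_of_nonneg (hg _)]
    exact hle p hp j
  have hfac : ∀ p : ℕ, p.Prime → ∑' j, g (p ^ j) ≤ Real.exp (S p * ∑' j, T j) := by
    intro p hp
    have hs := (hsum hp).of_norm
    rw [hs.tsum_eq_zero_add, pow_zero, h1, add_comm, ← tsum_mul_left]
    refine le_trans ?_ (Real.add_one_le_exp _)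
    exact add_le_add_left (((summable_nat_add_iff 1).mpr hs).tsum_le_tsum (hle p hp)
      (hT.mul_left (S p))) 1
  refine summable_of_sum_range_le (c := Real.exp ((∑' p, S p) * ∑' j, T j)) hg fun N => ?_
  have hsm := EulerProduct.summable_and_hasSum_smoothNumbers_prod_primesBelow_tsum h1 hmul hsum N
  calc ∑ n ∈ range N, g n
      = ∑ n ∈ (range N) with n ∈ N.smoothNumbers, g n := by
        refine (sum_filter_of_ne fun n hn hgn => ?_).symm
        refine Nat.mem_smoothNumbers_of_lt ?_ (mem_range.mp hn)
        rcases Nat.eq_zero_or_pos n with rfl | h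
        · exact absurd h0 hgn
        · exact h
    _ = ∑ n ∈ (range N).subtype (· ∈ N.smoothNumbers), g n := by
        rw [sum_subtype_eq_sum_filter]
    _ ≤ ∏ p ∈ N.primesBelow, ∑' j, g (p ^ j) :=
        sum_le_hasSum _ (fun n _ => hg n) hsm.2
    _ ≤ ∏ p ∈ N.primesBelow, Real.exp (S p * ∑' j, T j) := by
        refine prod_le_prod (fun p _ => tsum_nonneg fun j => hg _) fun p hp => ?_
        exact hfac p (Nat.prime_of_mem_primesBelow hp)
    _ ≤ _ := by
        rw [← Real.exp_sum, ← sum_mul]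
        gcongr
        · exact tsum_nonneg hT0
        · exact hS.sum_le_tsum _ fun p _ => hS0 p

lemma summable_abs_div_rpow {h : ArithmeticFunction ℝ} (hm : h.IsMultiplicative)
    (hb : PrimePowBounded h) {B : ℝ}
    (hB : ∀ p : ℕ, p.Prime → |h p| ≤ B / (p : ℝ) ^ (1 / 2 : ℝ)) :
    Summable fun n : ℕ => |h n| / (n : ℝ) ^ (3 / 4 : ℝ) := by
  obtain ⟨A, a, hA, hb⟩ := hb
  have hB0 : 0 ≤ B := by
    have h1 := (abs_nonneg _).trans (hB 2 Nat.prime_two)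
    have h2 : (0 : ℝ) < ((2 : ℕ) : ℝ) ^ (1 / 2 : ℝ) := by positivity
    exact (le_div_iff₀ h2).mp h1 |>.trans' (by simp)
  set r : ℝ := (2 : ℝ) ^ (-(3 / 4) : ℝ) with hr
  have hr0 : 0 < r := by positivity
  have hr1 : r < 1 := Real.rpow_lt_one_of_one_lt_of_neg one_lt_two (by norm_num)
  set T : ℕ → ℝ := fun j => (if j = 0 then B else 0)
    + A * (2 : ℝ) ^ (5 / 4 : ℝ) * (((j + 1 : ℕ) : ℝ) + 1) ^ a * r ^ (j + 1) with hT
  have hT0 : ∀ j, 0 ≤ T j := fun j => by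
    have : (0 : ℝ) ≤ if j = 0 then B else 0 := by split_ifs <;> simp [hB0]
    positivity
  have hTs : Summable T := by
    refine Summable.add ?_ ?_
    · refine summable_of_ne_finset_zero (s := {0}) fun j hj => ?_
      rw [mem_singleton] at hj
      rw [if_neg hj]
    · have := (summable_nat_add_iff 1).mpr (summable_succ_pow_mul_geometric a hr0.le hr1)
      refine (this.mul_left (A * (2 : ℝ) ^ (5 / 4 : ℝ))).congr fun j => by ring
  have hSs : Summable fun p : ℕ => 1 / (p : ℝ) ^ (5 / 4 : ℝ) :=
    Real.summable_one_div_nat_rpow.mpr (by norm_num)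
  refine summable_of_prime_pow_le (by simp) (by simp [hm.map_one]) ?_ (fun n => by positivity)
    hSs hTs (fun p => by positivity) hT0 ?_
  · intro m n hmn
    rw [hm.map_mul_of_coprime hmn, abs_mul, Nat.cast_mul,
      Real.mul_rpow (Nat.cast_nonneg m) (Nat.cast_nonneg n)]
    ring
  · intro p hp j
    have hp0 : (0 : ℝ) < p := by exact_mod_cast hp.pos
    have hp2 : (2 : ℝ) ≤ p := by exact_mod_cast hp.two_le
    rcases eq_or_ne j 0 with rfl | hj
    · have h2 : |h p| / (p : ℝ) ^ (3 / 4 : ℝ) ≤ 1 / (p : ℝ) ^ (5 / 4 : ℝ) * B := by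
        calc _ ≤ B / (p : ℝ) ^ (1 / 2 : ℝ) / (p : ℝ) ^ (3 / 4 : ℝ) := by
              gcongr; exact hB p hp
          _ = _ := by
              rw [div_div, ← Real.rpow_add hp0]
              norm_num
              ring
      rw [zero_add, pow_one]
      refine h2.trans (mul_le_mul_of_nonneg_left ?_ (by positivity))
      simp only [hT, if_pos]
      exact le_add_of_nonneg_right (by positivity)
    · set l := j + 1 with hl
      have hl2 : (2 : ℝ) ≤ l := by exact_mod_cast (show 2 ≤ l by omega)
      have key : 1 / ((p ^ l : ℕ) : ℝ) ^ (3 / 4 : ℝ)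
          ≤ 1 / (p : ℝ) ^ (5 / 4 : ℝ) * ((2 : ℝ) ^ (5 / 4 : ℝ) * r ^ l) := by
        have e1 : 1 / ((p ^ l : ℕ) : ℝ) ^ (3 / 4 : ℝ)
            = 1 / (p : ℝ) ^ (5 / 4 : ℝ) * (p : ℝ) ^ (-((l : ℝ) * (3 / 4) - 5 / 4)) := by
          push_cast
          rw [← Real.rpow_natCast, ← Real.rpow_mul hp0.le, one_div, one_div, ← Real.rpow_neg hp0.le,
            ← Real.rpow_neg hp0.le, ← Real.rpow_add hp0]
          ring_nf
        have e2 : (2 : ℝ) ^ (5 / 4 : ℝ) * r ^ l = (2 : ℝ) ^ (-((l : ℝ) * (3 / 4) - 5 / 4)) := by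
          rw [hr, ← Real.rpow_natCast, ← Real.rpow_mul (by norm_num), ← Real.rpow_add (by norm_num)]
          ring_nf
        rw [e1, e2]
        refine mul_le_mul_of_nonneg_left ?_ (by positivity)
        exact Real.rpow_le_rpow_of_nonpos (by norm_num) hp2 (by linarith)
      calc |h (p ^ l)| / ((p ^ l : ℕ) : ℝ) ^ (3 / 4 : ℝ)
          = |h (p ^ l)| * (1 / ((p ^ l : ℕ) : ℝ) ^ (3 / 4 : ℝ)) := by ring
        _ ≤ (A * ((l : ℝ) + 1) ^ a) *
            (1 / (p : ℝ) ^ (5 / 4 : ℝ) * ((2 : ℝ) ^ (5 / 4 : ℝ) * r ^ l)) := by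
            gcongr
            exact hb p hp l
        _ = _ := by
            simp only [hT, if_neg hj]
            ring

/-- The Euler product and the leading asymptotics of the summatory function of a multiplicative
function close to a divisor function on primes. -/
theorem exists_hasProd_and_abs_sum_sub_le {f : ArithmeticFunction ℝ} (hf : f.IsMultiplicative)
    (hb : PrimePowBounded f) (j : ℕ) {B : ℝ}
    (hB : ∀ p : ℕ, p.Prime → |f p - (j + 2 : ℕ)| ≤ B / (p : ℝ) ^ (1 / 2 : ℝ)) :
    ∃ H : ℝ, HasProd (fun p : Nat.Primes =>
        (1 - 1 / ((p : ℕ) : ℝ)) ^ (j + 2) * localFactor f p) H ∧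
      ∃ C : ℝ, 0 ≤ C ∧ ∀ x : ℝ, 1 ≤ x →
        |∑ n ∈ Ioc 0 ⌊x⌋₊, f n - H * (x * Real.log x ^ (j + 1) / (j + 1).factorial)|
          ≤ C * x * (1 + Real.log x) ^ j := by
  set h := f * (μ : ArithmeticFunction ℝ) ^ (j + 2) with hh
  have hhm : h.IsMultiplicative := hf.mul (isMultiplicative_moebius_pow _)
  have hhb : PrimePowBounded h := hb.mul (primePowBounded_moebius.pow _)
  have hfh : h * (ζ : ArithmeticFunction ℝ) ^ (j + 2) = f := by
    rw [hh, mul_assoc, ← mul_pow, coe_moebius_mul_coe_zeta, one_pow, mul_one]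
  have hs : Summable fun n : ℕ => |h n| / (n : ℝ) ^ (3 / 4 : ℝ) := by
    refine summable_abs_div_rpow hhm hhb (B := B) fun p hp => ?_
    rw [hh, mul_apply_prime hf.map_one (isMultiplicative_moebius_pow _).map_one hp,
      moebius_pow_apply_prime _ hp, ← sub_eq_add_neg]
    exact hB p hp
  obtain ⟨C, hC, has⟩ := exists_abs_sum_mul_zeta_pow_sub_le h j hs
  rw [hfh] at has
  refine ⟨_, ?_, C, hC, has⟩
  have hprod := EulerProduct.eulerProduct_hasProd (f := fun n => h n / n) (by simp [hhm.map_one])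
    (fun {m n} hmn => by
      rw [hhm.map_mul_of_coprime hmn]; push_cast; ring)
    ((summable_abs_div_mul_log hs).1.congr fun n => by
      rw [norm_div, Real.norm_eq_abs, Real.norm_natCast]) (by simp)
  have hfac : (fun p : Nat.Primes => (1 - 1 / ((p : ℕ) : ℝ)) ^ (j + 2) * localFactor f p)
      = fun p : Nat.Primes => ∑' e : ℕ, h ((p : ℕ) ^ e) / (((p : ℕ) ^ e : ℕ) : ℝ) := by
    funext p
    rw [mul_comm, ← localFactor_moebius_pow p.2,
      ← localFactor_mul hb (primePowBounded_moebius.pow _) p.2]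
    refine tsum_congr fun l => ?_
    push_cast
    rw [inv_pow, div_eq_mul_inv]
  rw [hfac]
  exact hprod

lemma dk_eq_card_finMulAntidiag (k n : ℕ) : dk k n = (Nat.finMulAntidiag k n).card := by
  unfold dk
  refine Nat.subtype_card _ fun f => ?_
  rw [Nat.mem_finMulAntidiag]
  constructor
  · rintro ⟨h, hn⟩
    refine ⟨fun i => Nat.pos_of_ne_zero fun hi => hn (h ▸ prod_eq_zero (mem_univ i) hi), h⟩
  · rintro ⟨h, rfl⟩
    exact ⟨rfl, (prod_pos fun i _ => h i).ne'⟩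

lemma dk_succ (k n : ℕ) : dk (k + 1) n = ∑ x ∈ n.divisorsAntidiagonal, dk k x.2 := by
  simp_rw [dk_eq_card_finMulAntidiag]
  rw [← card_sigma]
  refine card_nbij' (fun f => ⟨(f 0, ∏ i : Fin k, f i.succ), Fin.tail f⟩)
    (fun x => Fin.cons x.1.1 x.2) ?_ ?_ ?_ ?_
  · intro f hf
    simp only [mem_coe, Nat.mem_finMulAntidiag, Fin.prod_univ_succ] at hf
    simp only [mem_coe, mem_sigma, Nat.mem_divisorsAntidiagonal, Nat.mem_finMulAntidiag, Fin.tail]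
    refine ⟨hf, trivial, fun h => hf.2 ?_⟩
    rw [← hf.1, h, mul_zero]
  · rintro ⟨⟨a, b⟩, g⟩ hx
    simp only [mem_coe, mem_sigma, Nat.mem_divisorsAntidiagonal, Nat.mem_finMulAntidiag] at hx
    simp only [mem_coe, Nat.mem_finMulAntidiag, Fin.prod_univ_succ, Fin.cons_zero, Fin.cons_succ]
    rw [hx.2.1]
    exact hx.1
  · intro f _
    exact Fin.cons_self_tail f
  · rintro ⟨⟨a, b⟩, g⟩ hx
    simp only [mem_coe, mem_sigma, Nat.mem_divisorsAntidiagonal, Nat.mem_finMulAntidiag] at hx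
    simp [hx.2.1]

lemma zeta_pow_apply (k n : ℕ) : ((ζ : ArithmeticFunction ℝ) ^ k) n = dk k n := by
  induction k generalizing n with
  | zero =>
    rw [pow_zero, dk_eq_card_finMulAntidiag]
    rcases eq_or_ne n 1 with rfl | hn
    · simp [Nat.finMulAntidiag_one]
    · rw [one_apply_ne hn, Nat.finMulAntidiag_zero_left hn, card_empty, Nat.cast_zero]
  | succ k ih =>
    rw [pow_succ', mul_apply, dk_succ, Nat.cast_sum]
    refine sum_congr rfl fun x hx => ?_
    have hx0 : x.1 ≠ 0 := by
      rw [Nat.mem_divisorsAntidiagonal] at hx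
      rintro h
      exact hx.2 (by rw [← hx.1, h, zero_mul])
    rw [ih, natCoe_apply, zeta_apply_ne hx0, Nat.cast_one, one_mul]

lemma zeta_pow_succ_apply_prime_pow (k : ℕ) {p : ℕ} (hp : p.Prime) (l : ℕ) :
    ((ζ : ArithmeticFunction ℝ) ^ (k + 1)) (p ^ l) = ((l + k).choose k : ℕ) := by
  have hz : ∀ i : ℕ, (ζ : ArithmeticFunction ℝ) (p ^ i) = 1 := fun i => by
    rw [natCoe_apply, zeta_apply_ne (pow_ne_zero _ hp.ne_zero), Nat.cast_one]
  induction k generalizing l with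
  | zero => simpa using hz l
  | succ k ih =>
    rw [pow_succ, mul_apply_prime_pow _ _ hp, Finset.Nat.sum_antidiagonal_eq_sum_range_succ
      (fun a b => ((ζ : ArithmeticFunction ℝ) ^ (k + 1)) (p ^ a) * (ζ : ArithmeticFunction ℝ) (p ^ b))]
    simp_rw [ih, hz, mul_one]
    rw [← Nat.cast_sum, Nat.sum_range_add_choose]
    rfl

/-- The arithmetic function `n ↦ n ^ (-s)`. -/
noncomputable def negPow (s : ℝ) : ArithmeticFunction ℝ :=
  ⟨fun n => if n = 0 then 0 else (n : ℝ) ^ (-s), if_pos rfl⟩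

lemma negPow_apply {s : ℝ} {n : ℕ} (hn : n ≠ 0) : negPow s n = (n : ℝ) ^ (-s) := if_neg hn

lemma isMultiplicative_negPow (s : ℝ) : (negPow s).IsMultiplicative := by
  rw [IsMultiplicative.iff_ne_zero]
  refine ⟨by rw [negPow_apply one_ne_zero]; simp, fun {m n} hm hn _ => ?_⟩
  rw [negPow_apply hm, negPow_apply hn, negPow_apply (mul_ne_zero hm hn), Nat.cast_mul,
    Real.mul_rpow (Nat.cast_nonneg m) (Nat.cast_nonneg n)]

lemma abs_negPow_le_one {s : ℝ} (hs : 0 ≤ s) (n : ℕ) : |negPow s n| ≤ 1 := by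
  rcases eq_or_ne n 0 with rfl | hn
  · simp
  · rw [negPow_apply hn, abs_of_nonneg (by positivity)]
    refine Real.rpow_le_one_of_one_le_of_nonpos ?_ (by linarith)
    exact_mod_cast Nat.one_le_iff_ne_zero.mpr hn

/-- The arithmetic function `n ↦ φ(n) / n`. -/
noncomputable def totientRatio : ArithmeticFunction ℝ :=
  (μ : ArithmeticFunction ℝ).pmul (negPow 1) * ζ

/-- The arithmetic function `n ↦ ∑_{d ∣ n} d ^ (-1/2)`. -/
noncomputable def sigmaNegHalf : ArithmeticFunction ℝ := negPow (1 / 2) * ζ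

lemma totientRatio_apply (n : ℕ) : totientRatio n = ∑ d ∈ n.divisors, (μ d : ℝ) / d := by
  rw [totientRatio, coe_mul_zeta_apply]
  refine sum_congr rfl fun d hd => ?_
  rw [pmul_apply, negPow_apply (Nat.pos_of_mem_divisors hd).ne', Real.rpow_neg_one, intCoe_apply,
    div_eq_mul_inv]

lemma sigmaNegHalf_apply (n : ℕ) :
    sigmaNegHalf n = ∑ d ∈ n.divisors, (d : ℝ) ^ (-(1 / 2) : ℝ) := by
  rw [sigmaNegHalf, coe_mul_zeta_apply]
  exact sum_congr rfl fun d hd => negPow_apply (Nat.pos_of_mem_divisors hd).ne'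

lemma isMultiplicative_totientRatio : totientRatio.IsMultiplicative :=
  (isMultiplicative_moebius.intCast.pmul (isMultiplicative_negPow 1)).mul
    isMultiplicative_zeta.natCast

lemma isMultiplicative_sigmaNegHalf : sigmaNegHalf.IsMultiplicative :=
  (isMultiplicative_negPow _).mul isMultiplicative_zeta.natCast

lemma primePowBounded_totientRatio : PrimePowBounded totientRatio :=
  (primePowBounded_moebius.pmul (.of_abs_le_one (abs_negPow_le_one zero_le_one))).mul
    primePowBounded_zeta

lemma primePowBounded_sigmaNegHalf : PrimePowBounded sigmaNegHalf :=
  (PrimePowBounded.of_abs_le_one (abs_negPow_le_one (by norm_num))).mul primePowBounded_zeta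

lemma totientRatio_apply_prime_pow {p : ℕ} (hp : p.Prime) (l : ℕ) :
    totientRatio (p ^ (l + 1)) = 1 - 1 / (p : ℝ) := by
  rw [totientRatio_apply, Nat.sum_divisors_prime_pow hp, sum_range_succ', sum_range_succ']
  rw [sum_eq_zero fun i _ => by
    rw [moebius_apply_prime_pow hp (by omega), if_neg (by omega), Int.cast_zero, zero_div]]
  simp [moebius_apply_prime hp]
  ring

lemma sigmaNegHalf_apply_prime {p : ℕ} (hp : p.Prime) :
    sigmaNegHalf p = 1 + 1 / (p : ℝ) ^ (1 / 2 : ℝ) := by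
  rw [sigmaNegHalf_apply, hp.sum_divisors]
  rw [Real.rpow_neg (Nat.cast_nonneg p)]
  simp [add_comm]

/-- The arithmetic function `n ↦ d_k(n) ^ 2`. -/
noncomputable def dkSq (k : ℕ) : ArithmeticFunction ℝ :=
  ((ζ : ArithmeticFunction ℝ) ^ k).pmul ((ζ : ArithmeticFunction ℝ) ^ k)

lemma dkSq_apply (k n : ℕ) : dkSq k n = (dk k n : ℝ) ^ 2 := by
  rw [dkSq, pmul_apply, zeta_pow_apply, sq]

lemma isMultiplicative_dkSq (k : ℕ) : (dkSq k).IsMultiplicative :=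
  have h : ((ζ : ArithmeticFunction ℝ) ^ k).IsMultiplicative :=
    IsMultiplicative.pow isMultiplicative_zeta.natCast
  h.pmul h

lemma primePowBounded_dkSq (k : ℕ) : PrimePowBounded (dkSq k) :=
  (primePowBounded_zeta.pow k).pmul (primePowBounded_zeta.pow k)

lemma dkSq_apply_prime_pow {k : ℕ} (hk : 1 ≤ k) {p : ℕ} (hp : p.Prime) (l : ℕ) :
    dkSq k (p ^ l) = (((k + l - 1).choose (k - 1) : ℝ)) ^ 2 := by
  obtain ⟨k, rfl⟩ := Nat.exists_eq_add_of_le' hk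
  rw [dkSq, pmul_apply, zeta_pow_succ_apply_prime_pow k hp, ← sq]
  congr 4
  omega

lemma dkSq_apply_prime {k : ℕ} (hk : 1 ≤ k) {p : ℕ} (hp : p.Prime) :
    dkSq k p = (k ^ 2 : ℕ) := by
  have := dkSq_apply_prime_pow hk hp 1
  rw [pow_one] at this
  rw [this, Nat.add_sub_cancel, Nat.choose_symm_of_eq_add (b := 1) (by omega), Nat.choose_one_right]
  push_cast
  rfl

lemma localFactor_dkSq {k : ℕ} (hk : 1 ≤ k) {p : ℕ} (hp : p.Prime) :
    localFactor (dkSq k) p = frakA k p := by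
  refine tsum_congr fun l => ?_
  rw [dkSq_apply_prime_pow hk hp, inv_pow, div_eq_mul_inv]

lemma summable_dkSq_prime_pow (k : ℕ) {p : ℕ} (hp : p.Prime) :
    Summable fun l : ℕ => dkSq k (p ^ l) * ((p : ℝ)⁻¹) ^ l :=
  ((primePowBounded_dkSq k).summable_norm hp (by positivity) (inv_prime_lt_one hp)).of_norm

lemma frakA_eq_one_add {k : ℕ} (hk : 1 ≤ k) {p : ℕ} (hp : p.Prime) :
    frakA k p = 1 + ∑' l : ℕ, dkSq k (p ^ (l + 1)) * ((p : ℝ)⁻¹) ^ (l + 1) := by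
  rw [← localFactor_dkSq hk hp, localFactor, (summable_dkSq_prime_pow k hp).tsum_eq_zero_add]
  simp [(isMultiplicative_dkSq k).map_one]

lemma dkSq_nonneg (k n : ℕ) : 0 ≤ dkSq k n := by
  rw [dkSq_apply]; positivity

lemma one_le_frakA {k : ℕ} (hk : 1 ≤ k) {p : ℕ} (hp : p.Prime) : 1 ≤ frakA k p := by
  rw [frakA_eq_one_add hk hp]
  refine le_add_of_nonneg_right (tsum_nonneg fun l => ?_)
  have := dkSq_nonneg k (p ^ (l + 1))
  positivity

lemma frakA_sub_one_le {k : ℕ} (hk : 1 ≤ k) {p : ℕ} (hp : p.Prime) :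
    frakA k p - 1 ≤ 2 * (frakA k 2 - 1) / p := by
  have hp0 : (0 : ℝ) < p := by exact_mod_cast hp.pos
  have hp2 : (2 : ℝ) ≤ p := by exact_mod_cast hp.two_le
  rw [frakA_eq_one_add hk hp, frakA_eq_one_add hk Nat.prime_two, add_sub_cancel_left,
    add_sub_cancel_left, mul_div_right_comm, ← tsum_mul_left]
  refine Summable.tsum_le_tsum (fun l => ?_)
    ((summable_nat_add_iff 1).mpr (summable_dkSq_prime_pow k hp))
    (((summable_nat_add_iff 1).mpr (summable_dkSq_prime_pow k Nat.prime_two)).mul_left _)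
  rw [dkSq_apply_prime_pow hk hp, dkSq_apply_prime_pow hk Nat.prime_two]
  have h : ((p : ℝ)⁻¹) ^ (l + 1) ≤ 2 / p * (((2 : ℕ) : ℝ)⁻¹) ^ (l + 1) := by
    have h1 : (p : ℝ)⁻¹ ≤ 2⁻¹ := inv_anti₀ (by norm_num) hp2
    calc ((p : ℝ)⁻¹) ^ (l + 1) = ((p : ℝ)⁻¹) ^ l * (p : ℝ)⁻¹ := pow_succ _ _
      _ ≤ (2⁻¹) ^ l * (p : ℝ)⁻¹ := by gcongr
      _ = _ := by push_cast; rw [pow_succ]; ring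
  calc _ ≤ (((k + (l + 1) - 1).choose (k - 1) : ℝ)) ^ 2 *
        (2 / p * (((2 : ℕ) : ℝ)⁻¹) ^ (l + 1)) := by gcongr
    _ = _ := by ring

lemma multipliable_totient_factor {k : ℕ} (hk : 1 ≤ k) :
    Multipliable fun p : Nat.Primes => 1 - (1 - (frakA k p)⁻¹) / ((p : ℕ) : ℝ) := by
  simp_rw [sub_eq_add_neg (1 : ℝ) (_ / _)]
  refine Real.multipliable_one_add_of_summable (Summable.neg ?_)
  have hs : Summable fun p : Nat.Primes => 2 * (frakA k 2 - 1) * (1 / (((p : ℕ) : ℝ) ^ 2)) :=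
    ((Real.summable_one_div_nat_pow.mpr one_lt_two).mul_left _).comp_injective
      Subtype.val_injective
  refine hs.of_nonneg_of_le (fun p => ?_) fun p => ?_
  · have := inv_le_one_of_one_le₀ (one_le_frakA hk p.2)
    have : 0 ≤ 1 - (frakA k p)⁻¹ := by linarith
    positivity
  · have h1 := one_le_frakA hk p.2
    have h2 := frakA_sub_one_le hk p.2
    have hp0 : (0 : ℝ) < (p : ℕ) := by exact_mod_cast p.2.pos
    have h3 : 1 - (frakA k p)⁻¹ ≤ frakA k p - 1 := by
      have h0 : 0 < frakA k p := by linarith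
      have : 0 ≤ (frakA k p - 1) ^ 2 / frakA k p := by positivity
      have e : (frakA k p - 1) ^ 2 / frakA k p = frakA k p - 1 - (1 - (frakA k p)⁻¹) := by
        field_simp
      linarith
    calc (1 - (frakA k p)⁻¹) / ((p : ℕ) : ℝ) ≤ (2 * (frakA k 2 - 1) / (p : ℕ)) / ((p : ℕ) : ℝ) := by
          gcongr; linarith
      _ = _ := by field_simp

lemma localFactor_dkSq_pmul_totientRatio {k : ℕ} (hk : 1 ≤ k) {p : ℕ} (hp : p.Prime) :
    localFactor ((dkSq k).pmul totientRatio) p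
      = frakA k p * (1 - (1 - (frakA k p)⁻¹) / (p : ℝ)) := by
  have hA := one_le_frakA hk hp
  have hp0 : (0 : ℝ) < p := by exact_mod_cast hp.pos
  have h : localFactor ((dkSq k).pmul totientRatio) p = 1 + (1 - 1 / (p : ℝ)) * (frakA k p - 1) := by
    rw [frakA_eq_one_add hk hp, add_sub_cancel_left, localFactor,
      (((primePowBounded_dkSq k).pmul primePowBounded_totientRatio).summable_norm hp (by positivity)
        (inv_prime_lt_one hp)).of_norm.tsum_eq_zero_add, ← tsum_mul_left]
    congr 1
    · simp [(isMultiplicative_dkSq k).map_one, isMultiplicative_totientRatio.map_one]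
    · refine tsum_congr fun l => ?_
      rw [pmul_apply, totientRatio_apply_prime_pow hp]
      ring
  rw [h]
  have : frakA k p ≠ 0 := by linarith
  field_simp
  ring

/-- Asymptotics of the mean of `d_k(n)^2 φ(n)/n`. -/
lemma exists_abs_sum_dkSq_totientRatio_sub_le {k j : ℕ} (hk : 1 ≤ k) (hj : k ^ 2 = j + 2) :
    ∃ C : ℝ, 0 ≤ C ∧ ∀ x : ℝ, 1 ≤ x →
      |∑ n ∈ Ioc 0 ⌊x⌋₊, ((dkSq k).pmul totientRatio) n
          - aTilde k * (x * Real.log x ^ (j + 1) / (j + 1).factorial)|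
        ≤ C * x * (1 + Real.log x) ^ j := by
  obtain ⟨H₁, hH₁, -⟩ := exists_hasProd_and_abs_sum_sub_le (isMultiplicative_dkSq k)
    (primePowBounded_dkSq k) j (B := 0) fun p hp => by
      rw [dkSq_apply_prime hk hp, hj]; simp
  obtain ⟨H₂, hH₂, C, hC, h⟩ := exists_hasProd_and_abs_sum_sub_le
    ((isMultiplicative_dkSq k).pmul isMultiplicative_totientRatio)
    ((primePowBounded_dkSq k).pmul primePowBounded_totientRatio) j (B := (k ^ 2 : ℕ)) fun p hp => by
      have hp1 : (1 : ℝ) ≤ p := by exact_mod_cast hp.one_le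
      have := totientRatio_apply_prime_pow hp 0
      rw [zero_add, pow_one] at this
      rw [pmul_apply, dkSq_apply_prime hk hp, this, ← hj,
        show ((k ^ 2 : ℕ) : ℝ) * (1 - 1 / (p : ℝ)) - (k ^ 2 : ℕ) = -(((k ^ 2 : ℕ) : ℝ) / p) by ring,
        abs_neg, abs_of_nonneg (by positivity)]
      gcongr
      exact Real.rpow_le_self_of_one_le hp1 (by norm_num)
  refine ⟨C, hC, ?_⟩
  have h1 : H₁ = aCst k := by
    rw [← hH₁.tprod_eq, aCst]
    refine tprod_congr fun p => ?_
    rw [localFactor_dkSq hk p.2, hj]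
  have h2 : H₂ = aTilde k := by
    have := hH₁.mul (multipliable_totient_factor hk).hasProd
    rw [aTilde, ← h1]
    refine hH₂.unique ?_
    convert this using 2 with p
    rw [localFactor_dkSq hk p.2, localFactor_dkSq_pmul_totientRatio hk p.2]
    ring
  rwa [h2] at h

/-- Upper bound for the mean of `d_k(n)^2 ∑_{d ∣ n} d^(-1/2)`. -/
lemma exists_abs_sum_dkSq_sigmaNegHalf_sub_le {k j : ℕ} (hk : 1 ≤ k) (hj : k ^ 2 = j + 2) :
    ∃ H C : ℝ, 0 ≤ C ∧ ∀ x : ℝ, 1 ≤ x →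
      |∑ n ∈ Ioc 0 ⌊x⌋₊, ((dkSq k).pmul sigmaNegHalf) n
          - H * (x * Real.log x ^ (j + 1) / (j + 1).factorial)|
        ≤ C * x * (1 + Real.log x) ^ j := by
  obtain ⟨H, -, C, hC, h⟩ := exists_hasProd_and_abs_sum_sub_le
    ((isMultiplicative_dkSq k).pmul isMultiplicative_sigmaNegHalf)
    ((primePowBounded_dkSq k).pmul primePowBounded_sigmaNegHalf) j (B := (k ^ 2 : ℕ))
    fun p hp => by
      rw [pmul_apply, dkSq_apply_prime hk hp, sigmaNegHalf_apply_prime hp, ← hj, mul_add, mul_one,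
        add_sub_cancel_left, abs_of_nonneg (by positivity), mul_one_div]
  exact ⟨H, C, hC, h⟩

lemma exists_tsupport_subset_Icc {f : ℝ → ℝ} (hf : HasCompactSupport f)
    (hf0 : tsupport f ⊆ Set.Ioi 0) : ∃ a b : ℝ, 0 < a ∧ 0 < b ∧ tsupport f ⊆ Set.Icc a b := by
  rcases (tsupport f).eq_empty_or_nonempty with h | h
  · exact ⟨1, 1, one_pos, one_pos, by simp [h]⟩
  · obtain ⟨a, ha⟩ := hf.isCompact.exists_isLeast h
    obtain ⟨b, hb⟩ := hf.isCompact.exists_isGreatest h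
    exact ⟨a, b, hf0 ha.1, hf0 hb.1, fun x hx => ⟨ha.2 hx, hb.2 hx⟩⟩

lemma eq_zero_of_tsupport_subset_Icc {f : ℝ → ℝ} {a b x : ℝ} (hf : tsupport f ⊆ Set.Icc a b)
    (hx : b < x) : f x = 0 :=
  image_eq_zero_of_notMem_tsupport fun h => hx.not_ge (hf h).2

/-- A smooth sum over the positive integers is its integral up to `O(√y)`, uniformly in `y > 0`. -/
lemma exists_abs_sum_smooth_sub_le {W : ℝ → ℝ} (hW : ContDiff ℝ 1 W) (hWs : HasCompactSupport W)
    {a b : ℝ} (ha : 0 < a) (hb : 0 < b) (hab : tsupport W ⊆ Set.Icc a b) (hW1 : ∫ u, W u = 1) :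
    ∃ C : ℝ, 0 ≤ C ∧ ∀ y : ℝ, 0 < y → ∀ N : ℕ, b * y ≤ N →
      |∑ n ∈ Ioc 0 N, W (n / y) - y| ≤ C * y ^ (1 / 2 : ℝ) := by
  set K := ∫ u, |deriv W u|
  have hK : 0 ≤ K := integral_nonneg fun u => abs_nonneg _
  refine ⟨K * b ^ (1 / 2 : ℝ) + (b ^ (1 / 2 : ℝ))⁻¹, by positivity, fun y hy N hN => ?_⟩
  have hy2 : 0 < y ^ (1 / 2 : ℝ) := by positivity
  have hby : b ^ (1 / 2 : ℝ) * y ^ (1 / 2 : ℝ) = (b * y) ^ (1 / 2 : ℝ) :=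
    (Real.mul_rpow hb.le hy.le).symm
  rcases le_or_gt 1 (b * y) with h | h
  · have := abs_sum_mul_smooth_sub_le hW hWs hab (fun _ => 1) hy hN (M := y) (E := 1) fun u hu => by
      have hu0 : 0 ≤ u * y := mul_nonneg (ha.le.trans hu.1) hy.le
      have h1 := Nat.floor_le hu0
      have h2 := Nat.lt_floor_add_one (u * y)
      rw [sum_const, Nat.card_Ioc, Nat.sub_zero, nsmul_eq_mul, mul_one, abs_le]
      constructor <;> linarith
    rw [hW1, mul_one, one_mul] at this
    simp_rw [one_mul] at this
    calc _ ≤ K := this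
      _ ≤ K * (b * y) ^ (1 / 2 : ℝ) :=
        le_mul_of_one_le_right hK (Real.one_le_rpow h (by norm_num))
      _ = K * b ^ (1 / 2 : ℝ) * y ^ (1 / 2 : ℝ) := by rw [← hby]; ring
      _ ≤ _ := by gcongr; exact le_add_of_nonneg_right (by positivity)
  · have h0 : ∑ n ∈ Ioc 0 N, W (n / y) = 0 := sum_eq_zero fun n hn => by
      refine eq_zero_of_tsupport_subset_Icc hab ((lt_div_iff₀ hy).mpr (h.trans_le ?_))
      exact_mod_cast (mem_Ioc.mp hn).1
    rw [h0, zero_sub, abs_neg, abs_of_pos hy]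
    calc y = y ^ (1 / 2 : ℝ) * y ^ (1 / 2 : ℝ) := by
          rw [← Real.rpow_add hy]; norm_num
      _ ≤ (b ^ (1 / 2 : ℝ))⁻¹ * y ^ (1 / 2 : ℝ) := by
          gcongr
          rw [← one_div, le_div_iff₀ (by positivity), mul_comm, hby]
          exact Real.rpow_le_one (by positivity) h.le (by norm_num)
      _ ≤ _ := by gcongr; exact le_add_of_nonneg_left (by positivity)

lemma abs_pow_succ_sub_pow_succ_le {x y B : ℝ} (hx : 0 ≤ x) (hy : 0 ≤ y) (hxy : |x - y| ≤ B)
    (j : ℕ) : |x ^ (j + 1) - y ^ (j + 1)| ≤ (j + 1) * B * (y + B) ^ j := by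
  obtain ⟨h1, h2⟩ := abs_le.mp hxy
  have hB : 0 ≤ B := (abs_nonneg _).trans hxy
  rcases le_total y x with h | h
  · rw [abs_of_nonneg (sub_nonneg.mpr (by gcongr))]
    refine (pow_succ_sub_pow_succ_le j hy h).trans ?_
    gcongr; linarith
  · rw [abs_sub_comm, abs_of_nonneg (sub_nonneg.mpr (by gcongr))]
    refine (pow_succ_sub_pow_succ_le j hx h).trans ?_
    gcongr <;> linarith

/-- Dilating an asymptotic formula by `u` in a compact subset of `(0, ∞)`. -/
lemma exists_abs_sum_dilate_sub_le {c : ℕ → ℝ} {H C : ℝ} (hC : 0 ≤ C) {j : ℕ}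
    (hc : ∀ x : ℝ, 1 ≤ x → |∑ n ∈ Ioc 0 ⌊x⌋₊, c n - H * (x * Real.log x ^ (j + 1))|
      ≤ C * x * (1 + Real.log x) ^ j)
    {a b : ℝ} (ha : 0 < a) (hb : 0 < b) {L₀ : ℝ} (hL₀ : 0 < L₀) :
    ∃ K : ℝ, 0 ≤ K ∧ ∀ X : ℝ, 0 < X → L₀ ≤ Real.log X → ∀ u ∈ Set.Icc a b,
      |∑ n ∈ Ioc 0 ⌊u * X⌋₊, c n - H * (X * Real.log X ^ (j + 1)) * u|
        ≤ K * (X * Real.log X ^ j) := by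
  set B := max |Real.log a| |Real.log b|
  have hB : 0 ≤ B := (abs_nonneg _).trans (le_max_left _ _)
  set D := 1 + (1 + B) / L₀
  have hD : 0 ≤ D := by positivity
  refine ⟨(C * b + |H| * b * ((j + 1) * B)) * D ^ j + |H| * b * B, by positivity,
    fun X hX hL u hu => ?_⟩
  set L := Real.log X
  have hL0 : 0 < L := hL₀.trans_le hL
  have hu0 : 0 < u := ha.trans_le hu.1
  have hlogu : |Real.log u| ≤ B :=
    abs_le_max_abs_abs (Real.log_le_log ha hu.1) (Real.log_le_log hu0 hu.2)
  have hlog : Real.log (u * X) = Real.log u + L := Real.log_mul hu0.ne' hX.ne'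
  have hDL : L + (1 + B) ≤ D * L := by
    have : 1 + B = (1 + B) / L₀ * L₀ := by field_simp
    have : (1 + B) / L₀ * L₀ ≤ (1 + B) / L₀ * L := by gcongr
    simp only [D]
    linarith
  have hub := (abs_le.mp hlogu).2
  have hlb := (abs_le.mp hlogu).1
  rcases le_or_gt 1 (u * X) with h | h
  · have hl0 : 0 ≤ Real.log (u * X) := Real.log_nonneg h
    have h1 := hc _ h
    have h2 : C * (u * X) * (1 + Real.log (u * X)) ^ j ≤ C * (b * X) * (D * L) ^ j := by
      gcongr
      · exact hu.2
      · linarith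
    have h3 : |H * (u * X * Real.log (u * X) ^ (j + 1)) - H * (X * L ^ (j + 1)) * u|
        ≤ |H| * (b * X) * ((j + 1) * B * (D * L) ^ j) := by
      rw [show H * (u * X * Real.log (u * X) ^ (j + 1)) - H * (X * L ^ (j + 1)) * u
        = H * (u * X) * (Real.log (u * X) ^ (j + 1) - L ^ (j + 1)) by ring, abs_mul, abs_mul,
        abs_of_pos (mul_pos hu0 hX)]
      gcongr
      · exact hu.2
      · refine (abs_pow_succ_sub_pow_succ_le hl0 hL0.le (B := B) ?_ j).trans ?_
        · rwa [hlog, add_sub_cancel_right]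
        · gcongr
          linarith
    have h4 : 0 ≤ |H| * b * B * (X * L ^ j) := by positivity
    refine (abs_sub_le _ (H * (u * X * Real.log (u * X) ^ (j + 1))) _).trans ?_
    calc _ ≤ C * (b * X) * (D * L) ^ j + |H| * (b * X) * ((j + 1) * B * (D * L) ^ j) :=
          add_le_add (h1.trans h2) h3
      _ ≤ C * (b * X) * (D * L) ^ j + |H| * (b * X) * ((j + 1) * B * (D * L) ^ j)
          + |H| * b * B * (X * L ^ j) := le_add_of_nonneg_right h4
      _ = _ := by rw [mul_pow]; ring
  · have hl0 : Real.log (u * X) < 0 := Real.log_neg (by positivity) h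
    have hLB : L ≤ B := by linarith
    rw [Nat.floor_eq_zero.mpr h, Ioc_self, sum_empty, zero_sub, abs_neg, abs_mul, abs_mul,
      abs_of_pos hu0, abs_of_pos (show 0 < X * L ^ (j + 1) by positivity)]
    have h4 : 0 ≤ (C * b + |H| * b * ((j + 1) * B)) * D ^ j * (X * L ^ j) := by positivity
    calc |H| * (X * L ^ (j + 1)) * u = |H| * u * L * (X * L ^ j) := by ring
      _ ≤ |H| * b * B * (X * L ^ j) := by gcongr; exact hu.2
      _ ≤ _ := by rw [add_mul]; exact le_add_of_nonneg_left h4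

/-- Smoothing an asymptotic formula for the partial sums of `c`. -/
lemma exists_abs_sum_mul_smooth_sub_le {W : ℝ → ℝ} (hW : ContDiff ℝ 1 W)
    (hWs : HasCompactSupport W) {a b : ℝ} (ha : 0 < a) (hb : 0 < b)
    (hab : tsupport W ⊆ Set.Icc a b) (hW1 : ∫ u, W u = 1) {c : ℕ → ℝ} {H C : ℝ} (hC : 0 ≤ C)
    {j : ℕ} (hc : ∀ x : ℝ, 1 ≤ x →
      |∑ n ∈ Ioc 0 ⌊x⌋₊, c n - H * (x * Real.log x ^ (j + 1) / (j + 1).factorial)|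
        ≤ C * x * (1 + Real.log x) ^ j)
    {L₀ : ℝ} (hL₀ : 0 < L₀) :
    ∃ K : ℝ, 0 ≤ K ∧ ∀ X : ℝ, 0 < X → L₀ ≤ Real.log X → ∀ N : ℕ, b * X ≤ N →
      |∑ n ∈ Ioc 0 N, c n * W (n / X)
          - H / (j + 1).factorial * (X * Real.log X ^ (j + 1))|
        ≤ K * (X * Real.log X ^ j) := by
  obtain ⟨K, hK, h⟩ := exists_abs_sum_dilate_sub_le (H := H / (j + 1).factorial) hC (j := j)
    (c := c) (fun x hx => by
      convert hc x hx using 3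
      ring) ha hb hL₀
  have hI : 0 ≤ ∫ u, |deriv W u| := integral_nonneg fun u => abs_nonneg _
  refine ⟨K * ∫ u, |deriv W u|, by positivity, fun X hX hL N hN => ?_⟩
  have := abs_sum_mul_smooth_sub_le hW hWs hab c hX hN (h X hX hL)
  rw [hW1, mul_one] at this
  linarith

lemma sum_divisors_gcd_moebius {n q : ℕ} (hn : n ≠ 0) :
    (if Nat.gcd n q = 1 then 1 else 0 : ℝ) = ∑ d ∈ n.divisors with d ∣ q, (μ d : ℝ) := by
  have h : n.divisors.filter (· ∣ q) = (n.gcd q).divisors := by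
    ext d
    simp [Nat.dvd_gcd_iff, hn]
  rw [h, ← Int.cast_sum, ← coe_mul_zeta_apply, moebius_mul_coe_zeta, one_apply]
  split_ifs <;> simp

lemma sum_filter_dvd_eq {W : ℝ → ℝ} {a b : ℝ} (hab : tsupport W ⊆ Set.Icc a b) {Q : ℝ}
    (hQ : 0 < Q) {N : ℕ} (hN : b * Q ≤ N) {d : ℕ} (hd : 0 < d) :
    ∑ q ∈ Ioc 0 N with d ∣ q, W (q / Q) = ∑ m ∈ Ioc 0 N, W (m / (Q / d)) := by
  have hinj : Set.InjOn (d * ·) (Ioc 0 N : Finset ℕ) :=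
    fun x _ y _ hxy => Nat.eq_of_mul_eq_mul_left hd hxy
  have : ∑ m ∈ Ioc 0 N, W (m / (Q / d)) = ∑ q ∈ (Ioc 0 N).image (d * ·), W (q / Q) := by
    rw [sum_image hinj]
    refine sum_congr rfl fun m _ => ?_
    congr 1
    push_cast
    field_simp
  rw [this]
  refine sum_subset (fun q hq => ?_) fun q hq hq' => ?_
  · obtain ⟨hq, m, rfl⟩ := mem_filter.mp hq
    rw [mem_Ioc] at hq
    refine mem_image.mpr ⟨m, mem_Ioc.mpr ⟨Nat.pos_of_mul_pos_left hq.1, ?_⟩, rfl⟩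
    exact (Nat.le_mul_of_pos_left m hd).trans hq.2
  · obtain ⟨m, hm, rfl⟩ := mem_image.mp hq
    rw [mem_Ioc] at hm
    refine eq_zero_of_tsupport_subset_Icc hab ((lt_div_iff₀ hQ).mpr (hN.trans_lt ?_))
    by_contra! hle
    exact hq' (mem_filter.mpr ⟨mem_Ioc.mpr ⟨Nat.mul_pos hd hm.1, by exact_mod_cast hle⟩,
      dvd_mul_right d m⟩)

/-- The smooth count of integers coprime to `n`. -/
lemma exists_abs_sum_coprime_sub_le {W : ℝ → ℝ} (hW : ContDiff ℝ 1 W) (hWs : HasCompactSupport W)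
    {a b : ℝ} (ha : 0 < a) (hb : 0 < b) (hab : tsupport W ⊆ Set.Icc a b) (hW1 : ∫ u, W u = 1) :
    ∃ C : ℝ, 0 ≤ C ∧ ∀ Q : ℝ, 0 < Q → ∀ N : ℕ, b * Q ≤ N → ∀ n : ℕ, n ≠ 0 →
      |∑ q ∈ Ioc 0 N, (if Nat.gcd n q = 1 then W (q / Q) else 0) - Q * totientRatio n|
        ≤ C * Q ^ (1 / 2 : ℝ) * sigmaNegHalf n := by
  obtain ⟨C, hC, h⟩ := exists_abs_sum_smooth_sub_le hW hWs ha hb hab hW1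
  refine ⟨C, hC, fun Q hQ N hN n hn => ?_⟩
  have e : ∑ q ∈ Ioc 0 N, (if Nat.gcd n q = 1 then W (q / Q) else 0)
      = ∑ d ∈ n.divisors, (μ d : ℝ) * ∑ m ∈ Ioc 0 N, W (m / (Q / d)) := by
    calc _ = ∑ q ∈ Ioc 0 N, ∑ d ∈ n.divisors, if d ∣ q then (μ d : ℝ) * W (q / Q) else 0 := by
          refine sum_congr rfl fun q _ => ?_
          rw [← sum_filter, ← sum_mul, ← sum_divisors_gcd_moebius hn, ite_mul, one_mul, zero_mul]
      _ = _ := by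
          rw [sum_comm]
          refine sum_congr rfl fun d hd => ?_
          rw [← sum_filter, ← mul_sum, sum_filter_dvd_eq hab hQ hN (Nat.pos_of_mem_divisors hd)]
  rw [e, totientRatio_apply, sigmaNegHalf_apply, mul_sum, mul_sum, ← sum_sub_distrib]
  refine (abs_sum_le_sum_abs _ _).trans (sum_le_sum fun d hd => ?_)
  have hd0 : (0 : ℝ) < d := by exact_mod_cast Nat.pos_of_mem_divisors hd
  have hd1 : (1 : ℝ) ≤ d := by exact_mod_cast Nat.pos_of_mem_divisors hd
  rw [show (μ d : ℝ) * ∑ m ∈ Ioc 0 N, W (m / (Q / d)) - Q * ((μ d : ℝ) / d)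
    = μ d * (∑ m ∈ Ioc 0 N, W (m / (Q / d)) - Q / d) by ring, abs_mul]
  have hμ : |(μ d : ℝ)| ≤ 1 := by exact_mod_cast abs_moebius_le_one
  have hs := h (Q / d) (by positivity) N (by
    refine le_trans ?_ hN
    gcongr
    exact div_le_self hQ.le hd1)
  calc _ ≤ 1 * (C * (Q / d) ^ (1 / 2 : ℝ)) := by gcongr
    _ = _ := by rw [Real.div_rpow hQ.le hd0.le, Real.rpow_neg hd0.le]; ring

lemma Dk_eq_sum {k : ℕ} {Φ Ψ : ℝ → ℝ} {a b a' b' : ℝ} (hΦ : tsupport Φ ⊆ Set.Icc a b)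
    (hΨ : tsupport (fun u => Ψ u ^ 2) ⊆ Set.Icc a' b') {Q X : ℝ} (hQ : 0 < Q) (hX : 0 < X)
    {M N : ℕ} (hM : b * Q ≤ M) (hN : b' * X ≤ N) :
    Dk k Φ Ψ Q X = ∑ n ∈ Ioc 0 N, dkSq k n * Ψ (n / X) ^ 2 *
      ∑ q ∈ Ioc 0 M, if Nat.gcd n q = 1 then Φ (q / Q) else 0 := by
  have hn : ∀ q : ℕ, (∑' n : ℕ, if Nat.gcd n q = 1 then (dk k n : ℝ) ^ 2 * Ψ (n / X) ^ 2 else 0)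
      = ∑ n ∈ Ioc 0 N, if Nat.gcd n q = 1 then dkSq k n * Ψ (n / X) ^ 2 else 0 := fun q => by
    simp_rw [← dkSq_apply]
    refine tsum_eq_sum fun n hn => ?_
    rcases Nat.eq_zero_or_pos n with rfl | hn0
    · simp
    · have : N < n := by
        by_contra! h
        exact hn (mem_Ioc.mpr ⟨hn0, h⟩)
      have : Ψ (n / X) ^ 2 = 0 := eq_zero_of_tsupport_subset_Icc (f := fun u => Ψ u ^ 2) hΨ
        ((lt_div_iff₀ hX).mpr (hN.trans_lt (by exact_mod_cast this)))
      rw [this, mul_zero, ite_self]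
  rw [Dk]
  simp_rw [hn]
  rw [tsum_eq_sum (s := Ioc 0 M) fun q hq => ?_]
  · simp_rw [mul_sum]
    rw [sum_comm]
    refine sum_congr rfl fun q hq => ?_
    rw [if_pos (Nat.succ_le_of_lt (mem_Ioc.mp hq).1)]
    refine sum_congr rfl fun n _ => ?_
    split_ifs <;> ring
  · split_ifs with h
    · have : M < q := by
        by_contra! h'
        exact hq (mem_Ioc.mpr ⟨h, h'⟩)
      rw [eq_zero_of_tsupport_subset_Icc hΦ
        ((lt_div_iff₀ hQ).mpr (hM.trans_lt (by exact_mod_cast this))), zero_mul]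
    · rfl

lemma exists_abs_Dk_sub_le {k j : ℕ} (hk : 1 ≤ k) (hj : k ^ 2 = j + 2) {Φ Ψ : ℝ → ℝ}
    (hΦ : ContDiff ℝ 1 Φ) (hΦs : HasCompactSupport Φ) (hΦ0 : tsupport Φ ⊆ Set.Ioi 0)
    (hΦ1 : ∫ u, Φ u = 1) (hΨ : ContDiff ℝ 1 Ψ) (hΨs : HasCompactSupport Ψ)
    (hΨ0 : tsupport Ψ ⊆ Set.Ioi 0) (hΨ1 : ∫ u, Ψ u ^ 2 = 1) {L₀ : ℝ} (hL₀ : 0 < L₀) :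
    ∃ A B : ℝ, 0 ≤ A ∧ 0 ≤ B ∧ ∀ Q X : ℝ, 0 < Q → 0 < X → L₀ ≤ Real.log X →
      |Dk k Φ Ψ Q X - aTilde k / (j + 1).factorial * Q * X * Real.log X ^ (j + 1)|
        ≤ A * (Q ^ (1 / 2 : ℝ) * X * Real.log X ^ (j + 1)) + B * (Q * X * Real.log X ^ j) := by
  obtain ⟨a, b, ha, hb, hab⟩ := exists_tsupport_subset_Icc hΦs hΦ0
  obtain ⟨a', b', ha', hb', hab'⟩ := exists_tsupport_subset_Icc hΨs hΨ0
  have hW : ContDiff ℝ 1 fun u => Ψ u ^ 2 := hΨ.pow 2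
  have hsub : tsupport (fun u => Ψ u ^ 2) ⊆ tsupport Ψ :=
    closure_mono fun u hu h => hu (by simp [h])
  have hWs : HasCompactSupport fun u => Ψ u ^ 2 :=
    hΨs.isCompact.of_isClosed_subset (isClosed_tsupport _) hsub
  have hWab := hsub.trans hab'
  obtain ⟨C₁, hC₁, h₁⟩ := exists_abs_sum_coprime_sub_le hΦ hΦs ha hb hab hΦ1
  obtain ⟨C₂, hC₂, h₂⟩ := exists_abs_sum_dkSq_totientRatio_sub_le hk hj
  obtain ⟨K₂, hK₂, h₂⟩ := exists_abs_sum_mul_smooth_sub_le hW hWs ha' hb' hWab hΨ1 hC₂ h₂ hL₀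
  obtain ⟨H, C₃, hC₃, h₃⟩ := exists_abs_sum_dkSq_sigmaNegHalf_sub_le hk hj
  obtain ⟨K₃, hK₃, h₃⟩ := exists_abs_sum_mul_smooth_sub_le hW hWs ha' hb' hWab hΨ1 hC₃ h₃ hL₀
  set H' := H / (j + 1).factorial
  refine ⟨C₁ * (|H'| + K₃ / L₀), K₂, by positivity, hK₂, fun Q X hQ hX hL => ?_⟩
  obtain ⟨M, hM⟩ := exists_nat_ge (b * Q)
  obtain ⟨N, hN⟩ := exists_nat_ge (b' * X)
  have hL0 : 0 < Real.log X := hL₀.trans_le hL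
  specialize h₂ X hX hL N hN
  specialize h₃ X hX hL N hN
  have hD : |Dk k Φ Ψ Q X
        - Q * ∑ n ∈ Ioc 0 N, ((dkSq k).pmul totientRatio) n * Ψ (n / X) ^ 2|
      ≤ C₁ * Q ^ (1 / 2 : ℝ)
        * ∑ n ∈ Ioc 0 N, ((dkSq k).pmul sigmaNegHalf) n * Ψ (n / X) ^ 2 := by
    rw [Dk_eq_sum hab hWab hQ hX hM hN, mul_sum, mul_sum, ← sum_sub_distrib]
    refine (abs_sum_le_sum_abs _ _).trans (sum_le_sum fun n hn => ?_)
    have h := h₁ Q hQ M hM n (mem_Ioc.mp hn).1.ne'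
    have h0 : 0 ≤ dkSq k n * Ψ (n / X) ^ 2 := mul_nonneg (dkSq_nonneg k n) (sq_nonneg _)
    rw [pmul_apply, pmul_apply]
    calc _ = |dkSq k n * Ψ (n / X) ^ 2 *
          (∑ q ∈ Ioc 0 M, (if Nat.gcd n q = 1 then Φ (q / Q) else 0) - Q * totientRatio n)| := by
          congr 1; ring
      _ ≤ dkSq k n * Ψ (n / X) ^ 2 * (C₁ * Q ^ (1 / 2 : ℝ) * sigmaNegHalf n) := by
          rw [abs_mul, abs_of_nonneg h0]; gcongr
      _ = _ := by ring
  have h3 : ∑ n ∈ Ioc 0 N, ((dkSq k).pmul sigmaNegHalf) n * Ψ (n / X) ^ 2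
      ≤ (|H'| + K₃ / L₀) * (X * Real.log X ^ (j + 1)) := by
    have e : K₃ * (X * Real.log X ^ j) ≤ K₃ / L₀ * (X * Real.log X ^ (j + 1)) := by
      calc _ = K₃ / L₀ * (X * Real.log X ^ j * L₀) := by field_simp
        _ ≤ K₃ / L₀ * (X * Real.log X ^ j * Real.log X) := by gcongr
        _ = _ := by ring
    have e' : H' * (X * Real.log X ^ (j + 1)) ≤ |H'| * (X * Real.log X ^ (j + 1)) := by
      gcongr; exact le_abs_self _
    linarith [(abs_le.mp h₃).2]
  refine (abs_sub_le _ (Q * ∑ n ∈ Ioc 0 N, ((dkSq k).pmul totientRatio) n * Ψ (n / X) ^ 2)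
    _).trans (add_le_add (hD.trans ?_) ?_)
  · calc _ ≤ C₁ * Q ^ (1 / 2 : ℝ) * ((|H'| + K₃ / L₀) * (X * Real.log X ^ (j + 1))) := by gcongr
      _ = _ := by ring
  · calc _ = Q * |∑ n ∈ Ioc 0 N, ((dkSq k).pmul totientRatio) n * Ψ (n / X) ^ 2
          - aTilde k / (j + 1).factorial * (X * Real.log X ^ (j + 1))| := by
          rw [← abs_of_pos hQ, ← abs_mul, abs_of_pos hQ]; congr 1; ring
      _ ≤ Q * (K₂ * (X * Real.log X ^ j)) := by gcongr
      _ = _ := by ring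

end

/-- asymptotics of the diagonal contribution `D_k(Q;X)` for `X ≥ Q^δ`. -/
theorem diagonal_averaged (k : ℕ) (hk : 2 ≤ k) (δ : ℝ) (hδ : 0 < δ)
    (ε : ℝ) (hε : 0 < ε)
    (Φ Ψ : ℝ → ℝ)
    (hΦsmooth : ContDiff ℝ (⊤ : ℕ∞) Φ) (hΦsupp : HasCompactSupport Φ)
    (hΦpos : ∀ x, 0 ≤ Φ x) (hΦsupp' : tsupport Φ ⊆ Set.Ioi 0)
    (hΦint : ∫ u, Φ u = 1)
    (hΨsmooth : ContDiff ℝ (⊤ : ℕ∞) Ψ) (hΨsupp : HasCompactSupport Ψ)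
    (hΨpos : ∀ x, 0 ≤ Ψ x) (hΨsupp' : tsupport Ψ ⊆ Set.Ioi 0)
    (hΨint : ∫ u, (Ψ u)^2 = 1) :
    ∃ Cε : ℝ, ∀ Q X : ℝ, 2 ≤ Q → Q ^ δ ≤ X →
      |Dk k Φ Ψ Q X - (aTilde k / ((k^2 - 1).factorial : ℝ)) * Q * X * (Real.log X)^(k^2 - 1)| ≤
        Cε * (Q ^ ((1 : ℝ)/2 + ε) * X * (Real.log X)^(k^2 - 1)
          + Q * X * (Real.log X) ^ ((k^2 : ℝ) - 2 + ε)) := by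
  obtain ⟨j, hj⟩ : ∃ j, k ^ 2 = j + 2 := Nat.exists_eq_add_of_le' (by nlinarith)
  set L₀ := δ * Real.log 2
  have hL₀ : 0 < L₀ := mul_pos hδ (Real.log_pos one_lt_two)
  obtain ⟨A, B, hA, hB, h⟩ := exists_abs_Dk_sub_le (by omega) hj
    (hΦsmooth.of_le (mod_cast le_top)) hΦsupp hΦsupp' hΦint
    (hΨsmooth.of_le (mod_cast le_top)) hΨsupp hΨsupp' hΨint hL₀
  refine ⟨A + B / L₀ ^ ε, fun Q X hQ hX => ?_⟩
  have hQ0 : 0 < Q := by linarith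
  have hQδ : 0 < Q ^ δ := Real.rpow_pos_of_pos hQ0 δ
  have hX0 : 0 < X := hQδ.trans_le hX
  have hL : L₀ ≤ Real.log X := calc
    L₀ ≤ δ * Real.log Q := mul_le_mul_of_nonneg_left (Real.log_le_log two_pos hQ) hδ.le
    _ = Real.log (Q ^ δ) := (Real.log_rpow hQ0 δ).symm
    _ ≤ Real.log X := Real.log_le_log hQδ hX
  have hL0 : 0 < Real.log X := hL₀.trans_le hL
  have hk2 : (k : ℝ) ^ 2 - 2 + ε = j + ε := by
    have : (k : ℝ) ^ 2 = j + 2 := by exact_mod_cast hj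
    rw [this]; ring
  rw [hk2, Real.rpow_add hL0, Real.rpow_natCast, show k ^ 2 - 1 = j + 1 by omega]
  refine (h Q X hQ0 hX0 hL).trans ?_
  have h1 : A * (Q ^ (1 / 2 : ℝ) * X * Real.log X ^ (j + 1))
      ≤ A * (Q ^ (1 / 2 + ε) * X * Real.log X ^ (j + 1)) := by
    gcongr <;> linarith
  have h2 : B * (Q * X * Real.log X ^ j)
      ≤ B / L₀ ^ ε * (Q * X * (Real.log X ^ j * Real.log X ^ ε)) := by
    calc _ = B / L₀ ^ ε * (Q * X * (Real.log X ^ j * L₀ ^ ε)) := by field_simp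
      _ ≤ _ := by gcongr
  have h3 : 0 ≤ A * (Q * X * (Real.log X ^ j * Real.log X ^ ε)) := by positivity
  have h4 : 0 ≤ B / L₀ ^ ε * (Q ^ (1 / 2 + ε) * X * Real.log X ^ (j + 1)) := by positivity
  linarith
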